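/- There exist absolute constants C₀ > 0 and c > 0 such that the following holds for all n ≥ 2, d ≥ 1 and σ > 0: if σ ≤ C₀ n^{1/4} d^{-3/4}, then with probability at least 1 − c/n (over the Gaussian noise Δ = σW) the SDP relaxation has a unique global maximizer X̂, this maximizer has rank exactly d, and X̂ = R̂R̂ᵀ for some global maximizer R̂ of the program (P) whose d×d blocks are orthogonal. -/

import Mathlib

open Matrix MeasureTheory ProbabilityTheory
open scoped BigOperators ENNReal

noncomputable section

/-- Frobenius inner product `⟨X, Y⟩ = Tr (X Yᵀ)`. -/
def finner {m k : Type*} [Fintype m] [Fintype k] (X Y : Matrix m k ℝ) : ℝ :=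
  ∑ i, ∑ j, X i j * Y i j

/-- Frobenius norm. -/
def frobNorm {m k : Type*} [Fintype m] [Fintype k] (X : Matrix m k ℝ) : ℝ :=
  Real.sqrt (∑ i, ∑ j, (X i j) ^ 2)

/-- Spectral (ℓ²-operator) norm of a real matrix. -/
def opNorm {m k : Type*} [Fintype m] [Fintype k] [DecidableEq k] (X : Matrix m k ℝ) : ℝ :=
  ‖LinearMap.toContinuousLinearMap (Matrix.toEuclideanLin X)‖

/-- The `(i,j)` d×d block of an (nd)×(nd) matrix. -/
def blk {n d : ℕ} (M : Matrix (Fin n × Fin d) (Fin n × Fin d) ℝ) (i j : Fin n) :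
    Matrix (Fin d) (Fin d) ℝ := fun k l => M (i, k) (j, l)

/-- The i-th d×p block row of an (nd)×p matrix. -/
def rowBlk {n d p : ℕ} (S : Matrix (Fin n × Fin d) (Fin p) ℝ) (i : Fin n) :
    Matrix (Fin d) (Fin p) ℝ := fun k l => S (i, k) l

/-- The i-th (nd)×d block column of an (nd)×(nd) matrix. -/
def colBlk {n d : ℕ} (M : Matrix (Fin n × Fin d) (Fin n × Fin d) ℝ) (i : Fin n) :
    Matrix (Fin n × Fin d) (Fin d) ℝ := fun q l => M q (i, l)

/-- All d×p block rows lie in the Stiefel manifold St(d,p) (for p = d: are orthogonal). -/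
def StiefelBlocks {n d p : ℕ} (S : Matrix (Fin n × Fin d) (Fin p) ℝ) : Prop :=
  ∀ i, rowBlk S i * (rowBlk S i)ᵀ = 1

/-- The vertical stack Z of n copies of the identity I_d. -/
def Zmat (n d : ℕ) : Matrix (Fin n × Fin d) (Fin d) ℝ := fun q l => if q.2 = l then 1 else 0

/-- Feasibility for the SDP relaxation: symmetric, PSD, identity diagonal blocks. -/
def sdpFeasible {n d : ℕ} (X : Matrix (Fin n × Fin d) (Fin n × Fin d) ℝ) : Prop :=
  X.IsSymm ∧ X.PosSemidef ∧ ∀ i, blk X i i = 1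

/-- Global maximizer of the SDP relaxation with data `A`. -/
def sdpMaximizer {n d : ℕ} (A X : Matrix (Fin n × Fin d) (Fin n × Fin d) ℝ) : Prop :=
  sdpFeasible X ∧ ∀ Y, sdpFeasible Y → finner A Y ≤ finner A X

/-- Global maximizer of the program (P) with data `A`. -/
def progPMaximizer {n d : ℕ} (A : Matrix (Fin n × Fin d) (Fin n × Fin d) ℝ)
    (R : Matrix (Fin n × Fin d) (Fin d) ℝ) : Prop :=
  StiefelBlocks R ∧
    ∀ R' : Matrix (Fin n × Fin d) (Fin d) ℝ, StiefelBlocks R' →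
      finner A (R' * R'ᵀ) ≤ finner A (R * Rᵀ)

/-- The distance `d_F(S, Z) = min_{Q ∈ St(d,p)} ‖S − ZQ‖_F`. -/
def dF {n d p : ℕ} (S : Matrix (Fin n × Fin d) (Fin p) ℝ) : ℝ :=
  sInf {c | ∃ Q : Matrix (Fin d) (Fin p) ℝ, Q * Qᵀ = 1 ∧ c = frobNorm (S - Zmat n d * Q)}

/-- `Λ_{ii}(S) = (1/2) Σ_j (S_i S_jᵀ A_{ji} + A_{ij} S_j S_iᵀ)`. -/
def Lam {n d p : ℕ} (A : Matrix (Fin n × Fin d) (Fin n × Fin d) ℝ)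
    (S : Matrix (Fin n × Fin d) (Fin p) ℝ) (i : Fin n) : Matrix (Fin d) (Fin d) ℝ :=
  (1 / 2 : ℝ) •
    ∑ j, (rowBlk S i * (rowBlk S j)ᵀ * blk A j i + blk A i j * rowBlk S j * (rowBlk S i)ᵀ)

/-- Block diagonal matrix with given d×d diagonal blocks. -/
def blkDiag {n d : ℕ} (D : Fin n → Matrix (Fin d) (Fin d) ℝ) :
    Matrix (Fin n × Fin d) (Fin n × Fin d) ℝ :=
  fun q r => if q.1 = r.1 then D q.1 q.2 r.2 else 0

/-- Local maximizer of `f(S) = ⟨A, S Sᵀ⟩` over `St(d,p)^{⊗n}`. -/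
def isLocalMax {n d p : ℕ} (A : Matrix (Fin n × Fin d) (Fin n × Fin d) ℝ)
    (S : Matrix (Fin n × Fin d) (Fin p) ℝ) : Prop :=
  StiefelBlocks S ∧ ∃ ε > (0 : ℝ), ∀ S' : Matrix (Fin n × Fin d) (Fin p) ℝ,
    StiefelBlocks S' → frobNorm (S' - S) < ε → finner A (S' * S'ᵀ) ≤ finner A (S * Sᵀ)

/-- First-order criticality: `Σ_j A_{ij} S_j = Λ_{ii}(S) S_i` for all i. -/
def firstOrderCrit {n d p : ℕ} (A : Matrix (Fin n × Fin d) (Fin n × Fin d) ℝ)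
    (S : Matrix (Fin n × Fin d) (Fin p) ℝ) : Prop :=
  ∀ i, (∑ j, blk A i j * rowBlk S j) = Lam A S i * rowBlk S i

/-- Second-order necessary inequality over tangent directions. -/
def secondOrderIneq {n d p : ℕ} (A : Matrix (Fin n × Fin d) (Fin n × Fin d) ℝ)
    (S : Matrix (Fin n × Fin d) (Fin p) ℝ) : Prop :=
  ∀ Y : Matrix (Fin n × Fin d) (Fin p) ℝ,
    (∀ i, rowBlk S i * (rowBlk Y i)ᵀ + rowBlk Y i * (rowBlk S i)ᵀ = 0) →
    ∑ i, ∑ j, finner (blk A i j) (rowBlk Y i * (rowBlk Y j)ᵀ) ≤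
      ∑ i, finner (Lam A S i) (rowBlk Y i * (rowBlk Y i)ᵀ)

/-- Second-order critical point of `f`. -/
def secondOrderCrit {n d p : ℕ} (A : Matrix (Fin n × Fin d) (Fin n × Fin d) ℝ)
    (S : Matrix (Fin n × Fin d) (Fin p) ℝ) : Prop :=
  StiefelBlocks S ∧ firstOrderCrit A S ∧ secondOrderIneq A S

/-- Partial trace `Tr_d(Δ) ∈ ℝ^{n×n}`. -/
def partialTrace {n d : ℕ} (Δ : Matrix (Fin n × Fin d) (Fin n × Fin d) ℝ) :
    Matrix (Fin n) (Fin n) ℝ := fun i j => (blk Δ i j).trace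

/-- Singular values of a d×p real matrix (square roots of the eigenvalues of `M Mᴴ`). -/
def singVals {d p : ℕ} (M : Matrix (Fin d) (Fin p) ℝ) (i : Fin d) : ℝ :=
  Real.sqrt ((Matrix.isHermitian_mul_conjTranspose_self M).eigenvalues i)

/-- Nuclear norm: sum of singular values. -/
def nuclearNorm {d p : ℕ} (M : Matrix (Fin d) (Fin p) ℝ) : ℝ :=
  ∑ i, singVals M i

/-- The law of the iid standard Gaussian coordinates indexing the noise. -/
def gaussianEnsemble (n d : ℕ) :
    Measure (((Fin n × Fin d) × (Fin n × Fin d)) → ℝ) :=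
  Measure.pi fun _ => gaussianReal 0 1

/-- The symmetric Gaussian random matrix `W` built from the iid coordinates:
`W_{ii} = 0`, the entries of `W_{ij}` for `i < j` are iid standard Gaussians, and
`W_{ji} = W_{ij}ᵀ`. -/
def Wof {n d : ℕ} (ω : ((Fin n × Fin d) × (Fin n × Fin d)) → ℝ) :
    Matrix (Fin n × Fin d) (Fin n × Fin d) ℝ :=
  fun q r => if q.1 < r.1 then ω (q, r) else if r.1 < q.1 then ω (r, q) else 0

lemma Matrix.PosSemidef.transpose_eq_self {m : Type*} {H : Matrix m m ℝ} (hH : H.PosSemidef) :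
    Hᵀ = H := by
  have := hH.1
  rwa [IsHermitian, conjTranspose_eq_transpose_of_trivial] at this

section LinearAlgebra

open scoped Matrix.Norms.L2Operator MatrixOrder

variable {m k l : Type*} [Fintype m] [Fintype k] [Fintype l]

/-- Euclidean norm of a coordinate vector. -/
def vnorm (v : m → ℝ) : ℝ := ‖(WithLp.toLp 2 v : EuclideanSpace ℝ m)‖

lemma vnorm_nonneg (v : m → ℝ) : 0 ≤ vnorm v := norm_nonneg _

lemma vnorm_sq (v : m → ℝ) : vnorm v ^ 2 = v ⬝ᵥ v := by
  rw [vnorm, EuclideanSpace.norm_sq_eq]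
  simp [dotProduct, sq]

lemma dotProduct_le_vnorm (v w : m → ℝ) : v ⬝ᵥ w ≤ vnorm v * vnorm w := by
  have := real_inner_le_norm (WithLp.toLp 2 w : EuclideanSpace ℝ m) (WithLp.toLp 2 v)
  rw [EuclideanSpace.inner_toLp_toLp] at this
  simpa [vnorm, mul_comm] using this

lemma vnorm_pos {v : m → ℝ} (hv : v ≠ 0) : 0 < vnorm v := by
  rw [vnorm, norm_pos_iff]
  simpa using hv

lemma vnorm_eq_zero {v : m → ℝ} (hv : vnorm v = 0) : v = 0 := by
  by_contra h
  exact (vnorm_pos h).ne' hv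

lemma vnorm_smul (c : ℝ) (v : m → ℝ) : vnorm (c • v) = |c| * vnorm v := by
  rw [vnorm, WithLp.toLp_smul, norm_smul]; rfl

lemma vnorm_add_le (v w : m → ℝ) : vnorm (v + w) ≤ vnorm v + vnorm w := by
  rw [vnorm, WithLp.toLp_add]; exact norm_add_le _ _

lemma vnorm_sub_le (v w : m → ℝ) : vnorm (v - w) ≤ vnorm v + vnorm w := by
  rw [vnorm, WithLp.toLp_sub]; exact norm_sub_le _ _

lemma vnorm_mulVec_le [DecidableEq k] (M : Matrix m k ℝ) (v : k → ℝ) :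
    vnorm (M *ᵥ v) ≤ ‖M‖ * vnorm v := by
  simpa [vnorm] using Matrix.l2_opNorm_mulVec M (WithLp.toLp 2 v)

lemma norm_le_of_vnorm_mulVec [DecidableEq k] {M : Matrix m k ℝ} {t : ℝ} (ht : 0 ≤ t)
    (h : ∀ v, vnorm (M *ᵥ v) ≤ t * vnorm v) : ‖M‖ ≤ t := by
  rw [Matrix.l2_opNorm_def]
  refine ContinuousLinearMap.opNorm_le_bound _ ht fun x => ?_
  exact h x.ofLp

lemma norm_transpose_eq [DecidableEq m] [DecidableEq k] (M : Matrix m k ℝ) : ‖Mᵀ‖ = ‖M‖ := by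
  rw [← Matrix.l2_opNorm_conjTranspose M, conjTranspose_eq_transpose_of_trivial]

lemma bilin_le [DecidableEq k] (M : Matrix m k ℝ) (u : m → ℝ) (v : k → ℝ) :
    u ⬝ᵥ (M *ᵥ v) ≤ ‖M‖ * (vnorm u * vnorm v) := by
  have h1 := dotProduct_le_vnorm u (M *ᵥ v)
  have h2 := vnorm_mulVec_le M v
  nlinarith [vnorm_nonneg u]

lemma vnorm_mulVec_of_isometry [DecidableEq k] {Q : Matrix m k ℝ} (hQ : Qᵀ * Q = 1) (v : k → ℝ) :
    vnorm (Q *ᵥ v) = vnorm v := by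
  have : vnorm (Q *ᵥ v) ^ 2 = vnorm v ^ 2 := by
    rw [vnorm_sq, vnorm_sq, dotProduct_mulVec, vecMul_mulVec, hQ, vecMul_one]
  exact (sq_eq_sq₀ (vnorm_nonneg _) (vnorm_nonneg _)).1 this

lemma norm_le_one_of_isometry [DecidableEq k] {Q : Matrix m k ℝ} (hQ : Qᵀ * Q = 1) : ‖Q‖ ≤ 1 :=
  norm_le_of_vnorm_mulVec zero_le_one fun v => by rw [vnorm_mulVec_of_isometry hQ, one_mul]

lemma norm_le_of_eigenvalues [DecidableEq m] {T : Matrix m m ℝ} (hT : T.IsHermitian) {δ : ℝ}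
    (hδ : 0 ≤ δ) (h : ∀ (μ : ℝ) (v : m → ℝ), v ≠ 0 → T *ᵥ v = μ • v → |μ| ≤ δ) : ‖T‖ ≤ δ := by
  rw [hT.spectral_theorem, Unitary.conjStarAlgAut_apply]
  refine (norm_mul_le _ _).trans ?_
  have hu : ‖(hT.eigenvectorUnitary : Matrix m m ℝ)‖ ≤ 1 :=
    norm_le_one_of_isometry (by
      simpa [star_eq_conjTranspose] using Unitary.coe_star_mul_self hT.eigenvectorUnitary)
  have hu' : ‖(star hT.eigenvectorUnitary : Matrix m m ℝ)‖ ≤ 1 := by rwa [norm_star]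
  have hd : ‖(diagonal (RCLike.ofReal ∘ hT.eigenvalues) : Matrix m m ℝ)‖ ≤ δ := by
    rw [Matrix.l2_opNorm_diagonal, pi_norm_le_iff_of_nonneg hδ]
    intro i
    have := h (hT.eigenvalues i) (hT.eigenvectorBasis i) (by
      intro h0
      have h1 := hT.eigenvectorBasis.orthonormal.1 i
      rw [show hT.eigenvectorBasis i = 0 from by ext j; exact congrFun h0 j] at h1
      simp at h1) (hT.mulVec_eigenvectorBasis i)
    simpa using this
  have h2 := norm_mul_le (hT.eigenvectorUnitary : Matrix m m ℝ)
    (diagonal (RCLike.ofReal ∘ hT.eigenvalues) : Matrix m m ℝ)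
  have n1 := norm_nonneg (hT.eigenvectorUnitary : Matrix m m ℝ)
  have n2 := norm_nonneg (star hT.eigenvectorUnitary : Matrix m m ℝ)
  have n3 := norm_nonneg (diagonal (RCLike.ofReal ∘ hT.eigenvalues) : Matrix m m ℝ)
  have h3 : ‖(hT.eigenvectorUnitary : Matrix m m ℝ) *
    (diagonal (RCLike.ofReal ∘ hT.eigenvalues) : Matrix m m ℝ)‖ ≤ δ := by nlinarith
  nlinarith

lemma norm_sub_smul_one_le [DecidableEq m] {H : Matrix m m ℝ} (hH : H.PosSemidef) {r δ : ℝ}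
    (hδ : 0 ≤ δ) (hlo : ∀ v, (r - δ) * vnorm v ≤ vnorm (H *ᵥ v))
    (hhi : ∀ v, vnorm (H *ᵥ v) ≤ (r + δ) * vnorm v) : ‖H - r • 1‖ ≤ δ := by
  have hherm : (H - r • 1 : Matrix m m ℝ).IsHermitian :=
    hH.1.sub (by simp [IsHermitian])
  refine norm_le_of_eigenvalues hherm hδ fun μ v hv hμ => ?_
  have hHv : H *ᵥ v = (μ + r) • v := by
    rw [sub_mulVec, smul_mulVec, one_mulVec, sub_eq_iff_eq_add] at hμ
    rw [hμ, add_smul]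
  have hp := vnorm_pos hv
  have h0 : 0 ≤ μ + r := by
    have := hH.dotProduct_mulVec_nonneg v
    rw [hHv, star_trivial, dotProduct_smul, ← vnorm_sq, smul_eq_mul] at this
    exact nonneg_of_mul_nonneg_left this (by positivity)
  have h1 := hlo v
  have h2 := hhi v
  rw [hHv, vnorm_smul, abs_of_nonneg h0] at h1 h2
  have h3 := le_of_mul_le_mul_right h1 hp
  have h4 := le_of_mul_le_mul_right h2 hp
  rw [abs_le]; constructor <;> linarith

/-- Polar decomposition of a matrix close, in operator norm, to a multiple of an isometry. -/
lemma exists_polar [DecidableEq m] (M : Matrix m m ℝ) {r δ : ℝ} (hδ : 0 ≤ δ) (hr : δ < r)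
    (hlo : ∀ v, (r - δ) * vnorm v ≤ vnorm (Mᵀ *ᵥ v))
    (hhi : ∀ v, vnorm (Mᵀ *ᵥ v) ≤ (r + δ) * vnorm v) :
    ∃ H Q : Matrix m m ℝ, H.PosSemidef ∧ Q * Qᵀ = 1 ∧ M = H * Q ∧ ‖H - r • 1‖ ≤ δ := by
  have hMM : (M * Mᵀ).PosSemidef := by
    simpa [conjTranspose_eq_transpose_of_trivial] using posSemidef_self_mul_conjTranspose M
  have hU : IsUnit Mᵀ := by
    rw [← Matrix.mulVec_injective_iff_isUnit]
    intro v w hvw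
    have h1 := hlo (v - w)
    rw [mulVec_sub, show Mᵀ *ᵥ v = Mᵀ *ᵥ w from hvw, sub_self] at h1
    have h2 : vnorm (0 : m → ℝ) = 0 := by simp [vnorm]
    rw [h2] at h1
    have h3 : vnorm (v - w) = 0 := by
      have := vnorm_nonneg (v - w)
      nlinarith
    exact sub_eq_zero.1 (vnorm_eq_zero h3)
  have hUM : IsUnit M := by simpa using hU
  set H := CFC.sqrt (M * Mᵀ) with hHdef
  have hHH : H * H = M * Mᵀ := CFC.sqrt_mul_sqrt_self _ hMM.nonneg
  have hHp : H.PosSemidef := (CFC.sqrt_nonneg (M * Mᵀ)).posSemidef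
  have hHt : Hᵀ = H := hHp.transpose_eq_self
  have hHU : IsUnit H.det := by
    have h1 : IsUnit (H * H) := hHH ▸ hUM.mul hU
    rw [isUnit_iff_isUnit_det, det_mul] at h1
    exact isUnit_of_mul_isUnit_left h1
  have hQ : (H⁻¹ * M) * (H⁻¹ * M)ᵀ = 1 := by
    rw [transpose_mul, transpose_nonsing_inv, hHt, Matrix.mul_assoc, ← Matrix.mul_assoc M, ← hHH,
      Matrix.mul_assoc H, mul_nonsing_inv H hHU, Matrix.mul_one, nonsing_inv_mul H hHU]
  have hM : M = H * (H⁻¹ * M) := by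
    rw [← Matrix.mul_assoc, mul_nonsing_inv H hHU, Matrix.one_mul]
  have hn : ∀ v, vnorm (H *ᵥ v) = vnorm (Mᵀ *ᵥ v) := by
    intro v
    refine (sq_eq_sq₀ (vnorm_nonneg _) (vnorm_nonneg _)).1 ?_
    rw [vnorm_sq, vnorm_sq, dotProduct_mulVec, dotProduct_mulVec, vecMul_mulVec, vecMul_mulVec, hHt,
      hHH, transpose_transpose]
  exact ⟨H, H⁻¹ * M, hHp, hQ, hM, norm_sub_smul_one_le hHp hδ
    (fun v => by rw [hn]; exact hlo v) (fun v => by rw [hn]; exact hhi v)⟩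

lemma exists_polar_of_near [DecidableEq m] (M V : Matrix m m ℝ) {r δ : ℝ} (hδ : 0 ≤ δ) (hr : δ < r)
    (hV : V * Vᵀ = 1) (h : ‖M - r • V‖ ≤ δ) :
    ∃ H Q : Matrix m m ℝ, H.PosSemidef ∧ Q * Qᵀ = 1 ∧ M = H * Q ∧ ‖H - r • 1‖ ≤ δ := by
  have key : ∀ v, Mᵀ *ᵥ v = (M - r • V)ᵀ *ᵥ v + r • (Vᵀ *ᵥ v) := fun v => by
    rw [← smul_mulVec, ← add_mulVec, transpose_sub, transpose_smul, sub_add_cancel]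
  have hs : ∀ v, vnorm ((M - r • V)ᵀ *ᵥ v) ≤ δ * vnorm v := fun v =>
    (vnorm_mulVec_le _ v).trans
      (mul_le_mul_of_nonneg_right (by rwa [norm_transpose_eq]) (vnorm_nonneg v))
  have hv : ∀ v, vnorm (r • (Vᵀ *ᵥ v)) = r * vnorm v := fun v => by
    rw [vnorm_smul, abs_of_pos (hδ.trans_lt hr), vnorm_mulVec_of_isometry (by simpa using hV)]
  refine exists_polar M hδ hr (fun v => ?_) (fun v => ?_)
  · have h1 := vnorm_sub_le (Mᵀ *ᵥ v) ((M - r • V)ᵀ *ᵥ v)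
    rw [show Mᵀ *ᵥ v - (M - r • V)ᵀ *ᵥ v = r • (Vᵀ *ᵥ v) from by rw [key]; simp, hv] at h1
    linarith [hs v]
  · rw [key]
    have h1 := vnorm_add_le ((M - r • V)ᵀ *ᵥ v) (r • (Vᵀ *ᵥ v))
    rw [hv] at h1
    linarith [hs v]

end LinearAlgebra

section Frobenius

open scoped Matrix.Norms.L2Operator

variable {m k l : Type*} [Fintype m] [Fintype k] [Fintype l]

lemma finner_eq_trace (X Y : Matrix m k ℝ) : finner X Y = (X * Yᵀ).trace := by
  simp [finner, Matrix.trace, Matrix.mul_apply]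

lemma finner_comm (X Y : Matrix m k ℝ) : finner X Y = finner Y X := by
  simp [finner, mul_comm]

lemma finner_add_left (X Y Z : Matrix m k ℝ) : finner (X + Y) Z = finner X Z + finner Y Z := by
  simp [finner_eq_trace, Matrix.add_mul]

lemma finner_add_right (X Y Z : Matrix m k ℝ) : finner X (Y + Z) = finner X Y + finner X Z := by
  simp [finner_eq_trace, Matrix.mul_add]

lemma finner_sub_left (X Y Z : Matrix m k ℝ) : finner (X - Y) Z = finner X Z - finner Y Z := by
  simp [finner_eq_trace, Matrix.sub_mul]

lemma finner_sub_right (X Y Z : Matrix m k ℝ) : finner X (Y - Z) = finner X Y - finner X Z := by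
  simp [finner_eq_trace, Matrix.mul_sub]

lemma finner_smul_left (c : ℝ) (X Y : Matrix m k ℝ) : finner (c • X) Y = c * finner X Y := by
  simp [finner_eq_trace]

lemma finner_mul_left (A : Matrix m l ℝ) (X : Matrix l k ℝ) (Y : Matrix m k ℝ) :
    finner (A * X) Y = finner X (Aᵀ * Y) := by
  rw [finner_eq_trace, finner_eq_trace, transpose_mul, transpose_transpose, Matrix.mul_assoc,
    trace_mul_comm, Matrix.mul_assoc]

lemma finner_mul_right (X : Matrix m l ℝ) (B : Matrix l k ℝ) (Y : Matrix m k ℝ) :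
    finner (X * B) Y = finner X (Y * Bᵀ) := by
  rw [finner_eq_trace, finner_eq_trace, transpose_mul, transpose_transpose, Matrix.mul_assoc]

lemma finner_self_nonneg (X : Matrix m k ℝ) : 0 ≤ finner X X :=
  Finset.sum_nonneg fun _ _ => Finset.sum_nonneg fun _ _ => mul_self_nonneg _

lemma eq_zero_of_finner_self {X : Matrix m k ℝ} (h : finner X X = 0) : X = 0 := by
  have h' : ∑ i, ∑ j, X i j * X i j = 0 := h
  ext i j
  have h1 := (Finset.sum_eq_zero_iff_of_nonneg
    (fun i _ => Finset.sum_nonneg fun j _ => mul_self_nonneg (X i j))).1 h' i (Finset.mem_univ _)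
  have h2 := (Finset.sum_eq_zero_iff_of_nonneg
    (fun j _ => mul_self_nonneg (X i j))).1 h1 j (Finset.mem_univ _)
  simpa using h2

lemma finner_sq_le (X Y : Matrix m k ℝ) : finner X Y ^ 2 ≤ finner X X * finner Y Y := by
  have := Finset.sum_mul_sq_le_sq_mul_sq (Finset.univ : Finset (m × k))
    (fun p => X p.1 p.2) (fun p => Y p.1 p.2)
  simpa [finner, Fintype.sum_prod_type, sq] using this

lemma finner_mul_eq_sum (A : Matrix m l ℝ) (X : Matrix l k ℝ) (Y : Matrix m k ℝ) :
    finner (A * X) Y = ∑ j, (Y.col j) ⬝ᵥ (A *ᵥ X.col j) := by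
  rw [finner, Finset.sum_comm]
  refine Finset.sum_congr rfl fun j _ => Finset.sum_congr rfl fun i _ => ?_
  rw [mul_comm]; rfl

lemma finner_self_eq_sum (X : Matrix m k ℝ) : finner X X = ∑ j, vnorm (X.col j) ^ 2 := by
  rw [finner, Finset.sum_comm]
  exact Finset.sum_congr rfl fun j _ => by rw [vnorm_sq]; rfl

lemma finner_mul_self_le [DecidableEq l] (A : Matrix m l ℝ) (X : Matrix l k ℝ) :
    finner (A * X) (A * X) ≤ ‖A‖ ^ 2 * finner X X := by
  rw [finner_self_eq_sum, finner_self_eq_sum, Finset.mul_sum]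
  refine Finset.sum_le_sum fun j _ => ?_
  rw [← mul_pow]
  exact pow_le_pow_left₀ (vnorm_nonneg _) (vnorm_mulVec_le A (X.col j)) 2

lemma finner_mul_le [DecidableEq m] (A : Matrix m m ℝ) (X : Matrix m k ℝ) :
    finner (A * X) X ≤ ‖A‖ * finner X X := by
  rw [finner_mul_eq_sum, finner_self_eq_sum, Finset.mul_sum]
  refine Finset.sum_le_sum fun j _ => ?_
  rw [sq]
  exact bilin_le A _ _

lemma neg_le_finner_mul [DecidableEq m] (A : Matrix m m ℝ) (X : Matrix m k ℝ) :
    -(‖A‖ * finner X X) ≤ finner (A * X) X := by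
  have := finner_mul_le (-A) X
  rw [norm_neg, ← neg_one_smul ℝ A, Matrix.smul_mul, finner_smul_left] at this
  linarith

lemma le_finner_mul_of_near [DecidableEq m] {H : Matrix m m ℝ} {r δ : ℝ}
    (h : ‖H - r • 1‖ ≤ δ) (X : Matrix m k ℝ) : (r - δ) * finner X X ≤ finner (H * X) X := by
  have h1 := neg_le_finner_mul (H - r • 1) X
  rw [Matrix.sub_mul, finner_sub_left, Matrix.smul_mul, Matrix.one_mul, finner_smul_left] at h1
  nlinarith [finner_self_nonneg X]

lemma norm_sq_le_finner [DecidableEq k] (X : Matrix m k ℝ) : ‖X‖ ≤ √(finner X X) := by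
  refine norm_le_of_vnorm_mulVec (Real.sqrt_nonneg _) fun v => ?_
  refine abs_le_of_sq_le_sq' ?_ (mul_nonneg (Real.sqrt_nonneg _) (vnorm_nonneg _)) |>.2
  rw [mul_pow, Real.sq_sqrt (finner_self_nonneg X), vnorm_sq, vnorm_sq, finner, Finset.sum_mul]
  refine Finset.sum_le_sum fun i _ => ?_
  have := Finset.sum_mul_sq_le_sq_mul_sq Finset.univ (X i) v
  simpa [mulVec, dotProduct, sq] using this

/-- The defect of optimality of an orthogonal polar factor. -/
lemma two_finner_polar [DecidableEq m] {H Q Q' : Matrix m m ℝ} (hH : Hᵀ = H)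
    (hQ : Q * Qᵀ = 1) (hQ' : Q' * Q'ᵀ = 1) :
    2 * finner (H * Q) (Q - Q') = finner (H * (Q - Q')) (Q - Q') := by
  have h1 : finner (H * Q) Q = H.trace := by
    rw [finner_eq_trace, Matrix.mul_assoc, hQ, Matrix.mul_one]
  have h2 : finner (H * Q') Q' = H.trace := by
    rw [finner_eq_trace, Matrix.mul_assoc, hQ', Matrix.mul_one]
  have h3 : finner (H * Q') Q = finner (H * Q) Q' := by
    rw [finner_mul_left, hH, finner_comm]
  rw [Matrix.mul_sub]
  simp only [finner_sub_left, finner_sub_right]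
  rw [h1, h2, h3]; ring

lemma finner_mul_self_nonneg {H : Matrix m m ℝ} (hH : H.PosSemidef) (X : Matrix m k ℝ) :
    0 ≤ finner (H * X) X := by
  rw [finner_mul_eq_sum]
  exact Finset.sum_nonneg fun j _ => by simpa using hH.dotProduct_mulVec_nonneg (X.col j)

end Frobenius

section Blocks

open scoped Matrix.Norms.L2Operator

variable {n d p q : ℕ}

lemma finner_eq_sum_rowBlk (X Y : Matrix (Fin n × Fin d) (Fin p) ℝ) :
    finner X Y = ∑ i, finner (rowBlk X i) (rowBlk Y i) := by
  simp [finner, rowBlk, Fintype.sum_prod_type]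

lemma rowBlk_mul (X : Matrix (Fin n × Fin d) (Fin p) ℝ) (P : Matrix (Fin p) (Fin q) ℝ) (i : Fin n) :
    rowBlk (X * P) i = rowBlk X i * P := rfl

lemma rowBlk_add (X Y : Matrix (Fin n × Fin d) (Fin p) ℝ) (i : Fin n) :
    rowBlk (X + Y) i = rowBlk X i + rowBlk Y i := rfl

lemma rowBlk_sub (X Y : Matrix (Fin n × Fin d) (Fin p) ℝ) (i : Fin n) :
    rowBlk (X - Y) i = rowBlk X i - rowBlk Y i := rfl

lemma rowBlk_smul (c : ℝ) (X : Matrix (Fin n × Fin d) (Fin p) ℝ) (i : Fin n) :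
    rowBlk (c • X) i = c • rowBlk X i := rfl

lemma ext_rowBlk {X Y : Matrix (Fin n × Fin d) (Fin p) ℝ} (h : ∀ i, rowBlk X i = rowBlk Y i) :
    X = Y := by
  ext ⟨i, a⟩ j
  exact congrFun (congrFun (h i) a) j

lemma transpose_mul_eq_sum (X : Matrix (Fin n × Fin d) (Fin p) ℝ)
    (Y : Matrix (Fin n × Fin d) (Fin q) ℝ) :
    Xᵀ * Y = ∑ i, (rowBlk X i)ᵀ * rowBlk Y i := by
  ext a b
  simp [Matrix.mul_apply, Matrix.sum_apply, rowBlk, Fintype.sum_prod_type]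

lemma vnorm_rowBlk_mulVec_le (X : Matrix (Fin n × Fin d) (Fin p) ℝ) (i : Fin n) (v : Fin p → ℝ) :
    vnorm (rowBlk X i *ᵥ v) ≤ vnorm (X *ᵥ v) := by
  refine abs_le_of_sq_le_sq' ?_ (vnorm_nonneg _) |>.2
  rw [vnorm_sq, vnorm_sq, dotProduct, dotProduct, Fintype.sum_prod_type]
  exact Finset.single_le_sum (f := fun i => ∑ a, (X *ᵥ v) (i, a) * (X *ᵥ v) (i, a))
    (fun i _ => Finset.sum_nonneg fun _ _ => mul_self_nonneg _) (Finset.mem_univ i)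

lemma norm_rowBlk_le (X : Matrix (Fin n × Fin d) (Fin p) ℝ) (i : Fin n) : ‖rowBlk X i‖ ≤ ‖X‖ :=
  norm_le_of_vnorm_mulVec (norm_nonneg _) fun v =>
    (vnorm_rowBlk_mulVec_le X i v).trans (vnorm_mulVec_le X v)

lemma StiefelBlocks.transpose_mul_rowBlk {R : Matrix (Fin n × Fin d) (Fin d) ℝ}
    (hR : StiefelBlocks R) (i : Fin n) : (rowBlk R i)ᵀ * rowBlk R i = 1 :=
  mul_eq_one_comm.1 (hR i)

lemma StiefelBlocks.transpose_mul_self {R : Matrix (Fin n × Fin d) (Fin d) ℝ}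
    (hR : StiefelBlocks R) : Rᵀ * R = (n : ℝ) • 1 := by
  rw [transpose_mul_eq_sum, Finset.sum_congr rfl fun i _ => hR.transpose_mul_rowBlk i]
  simp [← Nat.cast_smul_eq_nsmul ℝ]

lemma StiefelBlocks.finner_self {R : Matrix (Fin n × Fin d) (Fin d) ℝ}
    (hR : StiefelBlocks R) : finner R R = n * d := by
  rw [finner_eq_sum_rowBlk]
  have : ∀ i, finner (rowBlk R i) (rowBlk R i) = d := fun i => by
    rw [finner_eq_trace, hR i]; simp
  simp [this]

lemma StiefelBlocks.mul_orthogonal {R : Matrix (Fin n × Fin d) (Fin d) ℝ}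
    (hR : StiefelBlocks R) {Q : Matrix (Fin d) (Fin d) ℝ} (hQ : Q * Qᵀ = 1) :
    StiefelBlocks (R * Q) := fun i => by
  rw [rowBlk_mul, transpose_mul, Matrix.mul_assoc, ← Matrix.mul_assoc Q, hQ, Matrix.one_mul, hR i]

end Blocks

section Certificate

variable {n d p : ℕ}

lemma rowBlk_blkDiag_mul (H : Fin n → Matrix (Fin d) (Fin d) ℝ)
    (X : Matrix (Fin n × Fin d) (Fin p) ℝ) (i : Fin n) :
    rowBlk (blkDiag H * X) i = H i * rowBlk X i := by
  ext a b
  simp only [rowBlk, Matrix.mul_apply, blkDiag, Fintype.sum_prod_type, ite_mul, zero_mul]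
  rw [Finset.sum_eq_single i]
  · simp
  · intro j _ hj
    simp [hj.symm]
  · simp

lemma finner_blkDiag (H : Fin n → Matrix (Fin d) (Fin d) ℝ)
    (Y : Matrix (Fin n × Fin d) (Fin n × Fin d) ℝ) :
    finner (blkDiag H) Y = ∑ i, finner (H i) (blk Y i i) := by
  simp only [finner, blkDiag, blk, Fintype.sum_prod_type, ite_mul, zero_mul]
  refine Finset.sum_congr rfl fun i _ => Finset.sum_congr rfl fun a _ => ?_
  rw [Finset.sum_eq_single i]
  · simp
  · intro j _ hj
    simp [hj.symm]
  · simp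

lemma blkDiag_transpose {H : Fin n → Matrix (Fin d) (Fin d) ℝ} (hH : ∀ i, (H i)ᵀ = H i) :
    (blkDiag H)ᵀ = blkDiag H := by
  ext ⟨i, a⟩ ⟨j, b⟩
  simp only [blkDiag, transpose_apply]
  by_cases h : i = j
  · subst h
    simpa using congrFun (congrFun (hH i) a) b
  · simp [h, Ne.symm h]

lemma StiefelBlocks.sdpFeasible {R : Matrix (Fin n × Fin d) (Fin d) ℝ} (hR : StiefelBlocks R) :
    sdpFeasible (R * Rᵀ) := by
  refine ⟨by simp [IsSymm], ?_, hR⟩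
  simpa [conjTranspose_eq_transpose_of_trivial] using posSemidef_self_mul_conjTranspose R

open scoped Matrix.Norms.L2Operator MatrixOrder in
lemma sdpFeasible.exists_factor {Y : Matrix (Fin n × Fin d) (Fin n × Fin d) ℝ}
    (hY : sdpFeasible Y) :
    ∃ X : Matrix (Fin n × Fin d) (Fin n × Fin d) ℝ, Y = X * Xᵀ := by
  obtain ⟨C, hC⟩ := CStarAlgebra.nonneg_iff_eq_star_mul_self.1 hY.2.1.nonneg
  exact ⟨Cᵀ, by
    simpa [star_eq_conjTranspose, conjTranspose_eq_transpose_of_trivial] using hC⟩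

/-- A symmetric matrix annihilating `R` and coercive on the orthogonal complement of its range
is bounded below by the projection onto that complement. -/
lemma mul_finner_proj_le {k : Type*} [Fintype k] (hn : n ≠ 0)
    {R : Matrix (Fin n × Fin d) (Fin d) ℝ}
    (hR : StiefelBlocks R) {S : Matrix (Fin n × Fin d) (Fin n × Fin d) ℝ} (hS : Sᵀ = S)
    (hSR : S * R = 0) {μ : ℝ} (hμ : ∀ x, Rᵀ *ᵥ x = 0 → μ * vnorm x ^ 2 ≤ x ⬝ᵥ (S *ᵥ x))
    (X : Matrix (Fin n × Fin d) k ℝ) :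
    μ * finner (X - R * ((n : ℝ)⁻¹ • (Rᵀ * X))) (X - R * ((n : ℝ)⁻¹ • (Rᵀ * X))) ≤
      finner (S * X) X := by
  have hn' : (n : ℝ) ≠ 0 := Nat.cast_ne_zero.2 hn
  set W : Matrix (Fin d) k ℝ := (n : ℝ)⁻¹ • (Rᵀ * X) with hW
  set Z := X - R * W with hZ
  have hSZ : S * Z = S * X := by
    rw [hZ, Matrix.mul_sub, ← Matrix.mul_assoc, hSR, Matrix.zero_mul, sub_zero]
  have hRZ : Rᵀ * Z = 0 := by
    rw [hZ, Matrix.mul_sub, ← Matrix.mul_assoc, hR.transpose_mul_self, hW, Matrix.smul_mul,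
      Matrix.one_mul, smul_smul, mul_inv_cancel₀ hn', one_smul, sub_self]
  have h1 : finner (S * X) X = finner (S * Z) Z := by
    rw [hSZ, finner_mul_left, hS, finner_mul_left, hS, hSZ]
  rw [h1, finner_mul_eq_sum, finner_self_eq_sum, Finset.mul_sum]
  refine Finset.sum_le_sum fun j _ => hμ _ ?_
  ext a
  exact congrFun (congrFun hRZ a) j

/-- Sufficiency of a dual certificate for tightness of the relaxation. -/
lemma tight_of_certificate (hn : n ≠ 0) {R : Matrix (Fin n × Fin d) (Fin d) ℝ}
    (hR : StiefelBlocks R) {A B : Matrix (Fin n × Fin d) (Fin n × Fin d) ℝ} {c : ℝ}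
    (hAB : B = A + c • 1) (hB : Bᵀ = B) {H : Fin n → Matrix (Fin d) (Fin d) ℝ}
    (hH : ∀ i, (H i)ᵀ = H i) (hBR : ∀ i, rowBlk (B * R) i = H i * rowBlk R i) {μ : ℝ} (hμ0 : 0 < μ)
    (hμ : ∀ x, Rᵀ *ᵥ x = 0 → μ * vnorm x ^ 2 ≤ x ⬝ᵥ ((blkDiag H - B) *ᵥ x)) :
    sdpMaximizer A (R * Rᵀ) ∧ (∀ Y, sdpMaximizer A Y → Y = R * Rᵀ) ∧ (R * Rᵀ).rank = d ∧
      progPMaximizer A R := by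
  have hn' : (n : ℝ) ≠ 0 := Nat.cast_ne_zero.2 hn
  set S := blkDiag H - B with hSdef
  have hS : Sᵀ = S := by rw [hSdef, transpose_sub, blkDiag_transpose hH, hB]
  have hSR : S * R = 0 := by
    refine ext_rowBlk fun i => ?_
    rw [hSdef, Matrix.sub_mul, rowBlk_sub, rowBlk_blkDiag_mul, hBR, sub_self]
    rfl
  have hobj : ∀ Y, sdpFeasible Y → finner A Y = (∑ i, (H i).trace) - c * (n * d) - finner S Y := by
    intro Y hY
    have h1 : finner (blkDiag H) Y = ∑ i, (H i).trace := by
      rw [finner_blkDiag]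
      exact Finset.sum_congr rfl fun i _ => by rw [hY.2.2 i, finner_eq_trace]; simp
    have h2 : finner (1 : Matrix (Fin n × Fin d) (Fin n × Fin d) ℝ) Y = n * d := by
      have : (1 : Matrix (Fin n × Fin d) (Fin n × Fin d) ℝ) = blkDiag fun _ => 1 := by
        ext ⟨i, a⟩ ⟨j, b⟩
        simp only [Matrix.one_apply, blkDiag, Prod.mk.injEq]
        by_cases h : i = j <;> simp [h]
      rw [this, finner_blkDiag, Finset.sum_congr rfl fun i _ => by rw [hY.2.2 i]]
      simp [finner_eq_trace]
    rw [hSdef, finner_sub_left, h1, hAB, finner_add_left, finner_smul_left, h2]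
    ring
  have hfac : ∀ X : Matrix (Fin n × Fin d) (Fin n × Fin d) ℝ,
      finner S (X * Xᵀ) = finner (S * X) X := by
    intro X
    rw [finner_mul_right]
  have hfacR : finner S (R * Rᵀ) = 0 := by
    rw [← finner_mul_right, hSR]; simp [finner]
  have hopt : ∀ Y, sdpFeasible Y → finner A Y ≤ finner A (R * Rᵀ) := by
    intro Y hY
    rw [hobj Y hY, hobj _ hR.sdpFeasible, hfacR]
    obtain ⟨X, rfl⟩ := hY.exists_factor
    have h1 := mul_finner_proj_le hn hR hS hSR hμ X
    have h2 := finner_self_nonneg (X - R * ((n : ℝ)⁻¹ • (Rᵀ * X)))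
    rw [hfac]
    nlinarith
  refine ⟨⟨hR.sdpFeasible, hopt⟩, ?_, ?_, hR, fun R' hR' => hopt _ hR'.sdpFeasible⟩
  · rintro Y ⟨hY, hmax⟩
    have h0 := hmax _ hR.sdpFeasible
    rw [hobj Y hY, hobj _ hR.sdpFeasible, hfacR] at h0
    obtain ⟨X, rfl⟩ := hY.exists_factor
    have h1 := mul_finner_proj_le hn hR hS hSR hμ X
    rw [hfac] at h0
    have h2 := finner_self_nonneg (X - R * ((n : ℝ)⁻¹ • (Rᵀ * X)))
    have h3 : finner (X - R * ((n : ℝ)⁻¹ • (Rᵀ * X))) (X - R * ((n : ℝ)⁻¹ • (Rᵀ * X))) = 0 := by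
      nlinarith
    have h4 := sub_eq_zero.1 (eq_zero_of_finner_self h3)
    set W := (n : ℝ)⁻¹ • (Rᵀ * X)
    have h5 : X * Xᵀ = R * (W * Wᵀ) * Rᵀ := by
      rw [h4, transpose_mul]; simp only [Matrix.mul_assoc]
    let i : Fin n := ⟨0, Nat.pos_of_ne_zero hn⟩
    have h6 : rowBlk R i * (W * Wᵀ) * (rowBlk R i)ᵀ = 1 := by
      have := hY.2.2 i
      rw [h5] at this
      exact this
    have h7 : W * Wᵀ = 1 := by
      calc W * Wᵀ = ((rowBlk R i)ᵀ * rowBlk R i) * (W * Wᵀ) * ((rowBlk R i)ᵀ * rowBlk R i) := by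
            rw [hR.transpose_mul_rowBlk, Matrix.one_mul, Matrix.mul_one]
        _ = (rowBlk R i)ᵀ * (rowBlk R i * (W * Wᵀ) * (rowBlk R i)ᵀ) * rowBlk R i := by
            simp only [Matrix.mul_assoc]
        _ = 1 := by rw [h6, Matrix.mul_one, hR.transpose_mul_rowBlk]
    rw [h5, h7, Matrix.mul_one]
  · rw [rank_self_mul_transpose, ← rank_transpose_mul_self, hR.transpose_mul_self]
    have hU : IsUnit ((n : ℝ) • (1 : Matrix (Fin d) (Fin d) ℝ)) := by
      rw [isUnit_iff_isUnit_det, det_smul, det_one, mul_one]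
      exact (isUnit_iff_ne_zero.2 hn').pow _
    simpa using rank_of_isUnit _ hU

end Certificate

section Deterministic

open scoped Matrix.Norms.L2Operator

variable {n d : ℕ}

lemma StiefelBlocks.vnorm_mulVec {R : Matrix (Fin n × Fin d) (Fin d) ℝ} (hR : StiefelBlocks R)
    (i : Fin n) (v : Fin d → ℝ) : vnorm (rowBlk R i *ᵥ v) = vnorm v :=
  vnorm_mulVec_of_isometry (hR.transpose_mul_rowBlk i) v

lemma two_dotProduct_eq {m : Type*} [Fintype m] (x y : m → ℝ) :
    2 * (x ⬝ᵥ y) = vnorm x ^ 2 + vnorm y ^ 2 - vnorm (x - y) ^ 2 := by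
  simp only [vnorm_sq, sub_dotProduct, dotProduct_sub]
  rw [dotProduct_comm y x]; ring

/-- Polar decomposition of `Gᵀ R` when the blocks of `R` are uniformly close to those of `G`. -/
lemma exists_alignment (hn : 0 < n) {G R : Matrix (Fin n × Fin d) (Fin d) ℝ}
    (hG : StiefelBlocks G) (hR : StiefelBlocks R)
    (hRG : ∀ i, ‖rowBlk R i - rowBlk G i‖ ≤ 1 / 4) :
    ∃ P Q : Matrix (Fin d) (Fin d) ℝ, P.PosSemidef ∧ Q * Qᵀ = 1 ∧ Gᵀ * R = P * Q ∧
      ‖P - (n : ℝ) • 1‖ ≤ n / 32 := by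
  have hn' : (0 : ℝ) < n := Nat.cast_pos.2 hn
  refine exists_polar _ (by positivity) (by linarith) (fun v => ?_) (fun v => ?_)
  · have h1 : v ⬝ᵥ ((Gᵀ * R)ᵀ *ᵥ v) = ∑ i, (rowBlk G i *ᵥ v) ⬝ᵥ (rowBlk R i *ᵥ v) := by
      rw [mulVec_transpose, dotProduct_comm, ← dotProduct_mulVec, transpose_mul_eq_sum,
        sum_mulVec, dotProduct_sum]
      refine Finset.sum_congr rfl fun i _ => ?_
      rw [← mulVec_mulVec, dotProduct_mulVec, vecMul_transpose]
    have h2 : ∀ i, (1 - 1 / 32) * vnorm v ^ 2 ≤ (rowBlk G i *ᵥ v) ⬝ᵥ (rowBlk R i *ᵥ v) := by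
      intro i
      have h3 := two_dotProduct_eq (rowBlk R i *ᵥ v) (rowBlk G i *ᵥ v)
      rw [dotProduct_comm, hR.vnorm_mulVec, hG.vnorm_mulVec, ← sub_mulVec] at h3
      have h4 := vnorm_mulVec_le (rowBlk R i - rowBlk G i) v
      have h5 : vnorm ((rowBlk R i - rowBlk G i) *ᵥ v) ≤ 1 / 4 * vnorm v :=
        h4.trans (mul_le_mul_of_nonneg_right (hRG i) (vnorm_nonneg v))
      have h6 := pow_le_pow_left₀ (vnorm_nonneg _) h5 2
      nlinarith
    have h7 : n * ((1 - 1 / 32) * vnorm v ^ 2) ≤ v ⬝ᵥ ((Gᵀ * R)ᵀ *ᵥ v) := by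
      rw [h1]
      simpa using Finset.sum_le_sum fun i (_ : i ∈ Finset.univ) => h2 i
    have h8 := dotProduct_le_vnorm v ((Gᵀ * R)ᵀ *ᵥ v)
    rcases (vnorm_nonneg v).eq_or_lt with h0 | h0
    · rw [← h0, mul_zero]; exact vnorm_nonneg _
    · nlinarith
  · have h1 : ‖Gᵀ * R‖ ≤ n := by
      rw [transpose_mul_eq_sum]
      refine (norm_sum_le _ _).trans ?_
      refine (Finset.sum_le_sum (g := fun _ => (1 : ℝ)) fun i _ => ?_).trans (by simp)
      refine norm_le_one_of_isometry ?_
      rw [transpose_mul, transpose_transpose, Matrix.mul_assoc, ← Matrix.mul_assoc (rowBlk G i),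
        hG i, Matrix.one_mul, hR.transpose_mul_rowBlk]
    have h2 := vnorm_mulVec_le (Gᵀ * R)ᵀ v
    rw [norm_transpose_eq] at h2
    nlinarith [vnorm_nonneg v]

/-- The feasible points of (P) close to `G` blockwise in operator norm, and globally in
Frobenius norm. -/
def nearSet (G : Matrix (Fin n × Fin d) (Fin d) ℝ) (τ : ℝ) :
    Set (Matrix (Fin n × Fin d) (Fin d) ℝ) :=
  {R | StiefelBlocks R ∧ finner (R - G) (R - G) ≤ τ ^ 2 ∧ ∀ i, ‖rowBlk R i - rowBlk G i‖ ≤ 1 / 4}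

lemma continuous_finner {m k : Type*} [Fintype m] [Fintype k] {X : Type*} [TopologicalSpace X]
    {f g : X → Matrix m k ℝ} (hf : Continuous f) (hg : Continuous g) :
    Continuous fun x => finner (f x) (g x) := by
  unfold finner
  exact continuous_finsetSum _ fun i _ => continuous_finsetSum _ fun j _ =>
    (hf.matrix_elem i j).mul (hg.matrix_elem i j)

lemma isCompact_nearSet (G : Matrix (Fin n × Fin d) (Fin d) ℝ) (τ : ℝ) :
    IsCompact (nearSet G τ) := by
  have : ProperSpace (Matrix (Fin n × Fin d) (Fin d) ℝ) := FiniteDimensional.proper ℝ _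
  have hblk : ∀ i, Continuous fun R : Matrix (Fin n × Fin d) (Fin d) ℝ => rowBlk R i := fun i =>
    continuous_matrix fun a b => continuous_id.matrix_elem (i, a) b
  refine Metric.isCompact_of_isClosed_isBounded ?_ ?_
  · have h : nearSet G τ =
        (⋂ i, {R : Matrix (Fin n × Fin d) (Fin d) ℝ | rowBlk R i * (rowBlk R i)ᵀ = 1}) ∩
        ({R | finner (R - G) (R - G) ≤ τ ^ 2} ∩ ⋂ i, {R | ‖rowBlk R i - rowBlk G i‖ ≤ 1 / 4}) := by
      ext R
      simp [nearSet, StiefelBlocks]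
    rw [h]
    refine (isClosed_iInter fun i => ?_).inter (IsClosed.inter ?_ (isClosed_iInter fun i => ?_))
    · exact isClosed_eq ((hblk i).matrix_mul (hblk i).matrix_transpose) continuous_const
    · exact isClosed_le (continuous_finner (continuous_id.sub continuous_const)
        (continuous_id.sub continuous_const)) continuous_const
    · exact isClosed_le ((hblk i).sub continuous_const).norm continuous_const
  · refine isBounded_iff_forall_norm_le.2 ⟨√(n * d), fun R hR => ?_⟩
    have := norm_sq_le_finner R
    rwa [hR.1.finner_self] at this

end Deterministic

section Critical

open scoped Matrix.Norms.L2Operator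

variable {n d : ℕ}

/-- One blockwise polar step, applied to an aligned point, lands in `nearSet`. -/
lemma exists_polar_step (hn : 0 < n) {G R : Matrix (Fin n × Fin d) (Fin d) ℝ}
    (hG : StiefelBlocks G) (hR : StiefelBlocks R)
    {E : Matrix (Fin n × Fin d) (Fin n × Fin d) ℝ} {β γ τ : ℝ} (hβ : 0 < β) (hτ0 : 0 ≤ τ)
    (hEβ : ‖E‖ ≤ β) (hEγ : ∀ i, ‖rowBlk (E * G) i‖ ≤ γ) (hτ : 7 * β * √(n * d) ≤ n * τ)
    (hsmall : γ + β * τ + 2 * β ≤ n / 20) (hRτ : finner (R - G) (R - G) ≤ τ ^ 2)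
    {P : Matrix (Fin d) (Fin d) ℝ} (hP : P.PosSemidef) (hGR : Gᵀ * R = P)
    (hPn : ‖P - (n : ℝ) • 1‖ ≤ n / 32) :
    ∃ R' ∈ nearSet G τ, ∃ H : Fin n → Matrix (Fin d) (Fin d) ℝ, (∀ i, (H i).PosSemidef) ∧
      (∀ i, ‖H i - (n : ℝ) • 1‖ ≤ n / 10) ∧
      ∀ i, rowBlk ((G * Gᵀ + E + (2 * β) • 1) * R) i = H i * rowBlk R' i := by
  have hn' : (0 : ℝ) < n := Nat.cast_pos.2 hn
  set D := (E + (2 * β) • 1) * R with hD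
  have hM : ∀ i, rowBlk ((G * Gᵀ + E + (2 * β) • 1) * R) i = rowBlk G i * P + rowBlk D i := by
    intro i
    rw [add_assoc, Matrix.add_mul, Matrix.mul_assoc, hGR, ← hD]; rfl
  have hDi : ∀ i, ‖rowBlk D i‖ ≤ n / 20 := by
    intro i
    have h1 : rowBlk D i = rowBlk (E * G) i + rowBlk (E * (R - G)) i + (2 * β) • rowBlk R i := by
      rw [hD, ← rowBlk_add, ← Matrix.mul_add, add_sub_cancel, Matrix.add_mul, Matrix.smul_mul,
        Matrix.one_mul]; rfl
    have h2 : ‖rowBlk (E * (R - G)) i‖ ≤ β * τ := by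
      refine (norm_rowBlk_le _ i).trans ((Matrix.l2_opNorm_mul _ _).trans ?_)
      refine mul_le_mul hEβ ((norm_sq_le_finner _).trans ?_) (norm_nonneg _) hβ.le
      exact (Real.sqrt_le_left hτ0).2 hRτ
    have h3 : ‖(2 * β) • rowBlk R i‖ ≤ 2 * β := by
      rw [norm_smul, Real.norm_eq_abs, abs_of_pos (by positivity)]
      have := norm_le_one_of_isometry (hR.transpose_mul_rowBlk i)
      nlinarith
    rw [h1]
    have h4 := norm_add_le (rowBlk (E * G) i + rowBlk (E * (R - G)) i) ((2 * β) • rowBlk R i)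
    have h5 := norm_add_le (rowBlk (E * G) i) (rowBlk (E * (R - G)) i)
    linarith [hEγ i]
  have hDF : finner D D ≤ (3 * β) ^ 2 * (n * d) := by
    have h1 := finner_mul_self_le (E + (2 * β) • 1) R
    have h2 : ‖E + (2 * β) • (1 : Matrix (Fin n × Fin d) (Fin n × Fin d) ℝ)‖ ≤ 3 * β := by
      refine (norm_add_le _ _).trans ?_
      rw [norm_smul, Real.norm_eq_abs, abs_of_pos (by positivity)]
      have := norm_le_one_of_isometry (Q := (1 : Matrix (Fin n × Fin d) (Fin n × Fin d) ℝ))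
        (by simp)
      nlinarith
    rw [hR.finner_self] at h1
    refine h1.trans (mul_le_mul_of_nonneg_right ?_ (by positivity))
    exact pow_le_pow_left₀ (norm_nonneg _) h2 2
  have hGP : ∀ i, ‖rowBlk G i * (P - (n : ℝ) • 1)‖ ≤ n / 32 := by
    intro i
    have h1 := Matrix.l2_opNorm_mul (rowBlk G i) (P - (n : ℝ) • 1)
    have h2 := norm_le_one_of_isometry (hG.transpose_mul_rowBlk i)
    nlinarith [norm_nonneg (P - (n : ℝ) • (1 : Matrix (Fin d) (Fin d) ℝ))]
  have hpol : ∀ i, ∃ H Q : Matrix (Fin d) (Fin d) ℝ, H.PosSemidef ∧ Q * Qᵀ = 1 ∧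
      rowBlk G i * P + rowBlk D i = H * Q ∧ ‖H - (n : ℝ) • 1‖ ≤ n / 32 + n / 20 := by
    intro i
    refine exists_polar_of_near _ (rowBlk G i) (by positivity) (by linarith) (hG i) ?_
    have h1 : rowBlk G i * P + rowBlk D i - (n : ℝ) • rowBlk G i =
        rowBlk G i * (P - (n : ℝ) • 1) + rowBlk D i := by
      rw [Matrix.mul_sub, Matrix.mul_smul, Matrix.mul_one]; abel
    rw [h1]
    exact (norm_add_le _ _).trans (add_le_add (hGP i) (hDi i))
  choose H Q hHp hQ hHQ hHn using hpol
  let R' : Matrix (Fin n × Fin d) (Fin d) ℝ := fun q l => Q q.1 q.2 l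
  have hR'i : ∀ i, rowBlk R' i = Q i := fun i => rfl
  have hR' : StiefelBlocks R' := hQ
  refine ⟨R', ⟨hR', ?_, fun i => ?_⟩, H, hHp, fun i => (hHn i).trans (by linarith), fun i => ?_⟩
  · set X := R' - G with hX
    have h1 : ∀ i, 9 / 10 * n * finner (rowBlk X i) (rowBlk X i) ≤
        2 * finner (rowBlk D i) (rowBlk X i) := by
      intro i
      have e1 := two_finner_polar (hHp i).transpose_eq_self (hQ i) (hG i)
      have e2 := le_finner_mul_of_near (hHn i) (rowBlk X i)
      have e3 : 0 ≤ finner (rowBlk G i * P) (rowBlk G i - Q i) := by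
        have hU : ((rowBlk G i)ᵀ * Q i) * ((rowBlk G i)ᵀ * Q i)ᵀ = 1 := by
          rw [transpose_mul, transpose_transpose, Matrix.mul_assoc, ← Matrix.mul_assoc (Q i), hQ i,
            Matrix.one_mul, hG.transpose_mul_rowBlk]
        have e4 := two_finner_polar hP.transpose_eq_self
          (Q := 1) (Q' := (rowBlk G i)ᵀ * Q i) (by simp) hU
        have e5 := finner_mul_self_nonneg hP (1 - (rowBlk G i)ᵀ * Q i)
        rw [finner_mul_left, Matrix.mul_sub, hG.transpose_mul_rowBlk]
        rw [Matrix.mul_one] at e4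
        linarith
      rw [← hHQ] at e1
      have e6 : rowBlk X i = Q i - rowBlk G i := rfl
      rw [← e6, finner_add_left] at e1
      rw [show rowBlk G i - Q i = -(rowBlk X i) from by rw [e6, neg_sub], ← neg_one_smul ℝ,
        finner_comm, finner_smul_left, finner_comm] at e3
      have e7 := finner_self_nonneg (rowBlk X i)
      have e8 : 0 ≤ n * finner (rowBlk X i) (rowBlk X i) := by positivity
      linarith
    have h2 : 9 / 10 * n * finner X X ≤ 2 * finner D X := by
      rw [finner_eq_sum_rowBlk X X, finner_eq_sum_rowBlk D X, Finset.mul_sum, Finset.mul_sum]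
      exact Finset.sum_le_sum fun i _ => h1 i
    have h3 := finner_sq_le D X
    have h4 := finner_self_nonneg X
    have h5 : (7 * β * √(n * d)) ^ 2 ≤ (n * τ) ^ 2 := pow_le_pow_left₀ (by positivity) hτ 2
    rw [mul_pow, Real.sq_sqrt (by positivity)] at h5
    have h6 : (9 / 10 * n * finner X X) ^ 2 ≤ (2 * finner D X) ^ 2 :=
      pow_le_pow_left₀ (by positivity) h2 2
    have h7 : (9 / 10 * n * finner X X) ^ 2 ≤ 4 * ((3 * β) ^ 2 * (n * d)) * finner X X := by
      nlinarith
    rcases h4.eq_or_lt with h0 | h0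
    · rw [← h0]; positivity
    · have h8 : (9 / 10 * n) ^ 2 * finner X X ≤ 4 * ((3 * β) ^ 2 * (n * d)) := by
        refine le_of_mul_le_mul_right ?_ h0
        nlinarith
      have h9 : (n : ℝ) ^ 2 * finner X X ≤ n ^ 2 * τ ^ 2 := by
        have : 0 ≤ β ^ 2 * (n * d) := by positivity
        nlinarith
      exact le_of_mul_le_mul_left h9 (by positivity)
  · have h1 : (n : ℝ) • (rowBlk R' i - rowBlk G i) =
        rowBlk D i + rowBlk G i * (P - (n : ℝ) • 1) - (H i - (n : ℝ) • 1) * Q i := by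
      rw [Matrix.mul_sub, Matrix.sub_mul, ← hHQ i, hR'i, Matrix.mul_smul, Matrix.smul_mul,
        Matrix.mul_one, Matrix.one_mul, smul_sub]; abel
    have h2 : ‖(H i - (n : ℝ) • 1) * Q i‖ ≤ n / 32 + n / 20 := by
      have h3 := Matrix.l2_opNorm_mul (H i - (n : ℝ) • 1) (Q i)
      have h4 := norm_le_one_of_isometry (mul_eq_one_comm.1 (hQ i))
      nlinarith [norm_nonneg (H i - (n : ℝ) • (1 : Matrix (Fin d) (Fin d) ℝ)), hHn i]
    have h5 : ‖(n : ℝ) • (rowBlk R' i - rowBlk G i)‖ ≤ n * (1 / 4) := by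
      rw [h1]
      have h6 := norm_sub_le (rowBlk D i + rowBlk G i * (P - (n : ℝ) • 1))
        ((H i - (n : ℝ) • 1) * Q i)
      have h7 := norm_add_le (rowBlk D i) (rowBlk G i * (P - (n : ℝ) • 1))
      linarith [hDi i, hGP i]
    rw [norm_smul, Real.norm_eq_abs, abs_of_pos hn'] at h5
    exact le_of_mul_le_mul_left h5 hn'
  · rw [hM, hHQ, hR'i]

lemma exists_critical (hn : 0 < n) {G : Matrix (Fin n × Fin d) (Fin d) ℝ}
    (hG : StiefelBlocks G)
    {E : Matrix (Fin n × Fin d) (Fin n × Fin d) ℝ} (hE : Eᵀ = E) {β γ τ : ℝ} (hβ : 0 < β)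
    (hτ0 : 0 ≤ τ)
    (hEβ : ‖E‖ ≤ β) (hEγ : ∀ i, ‖rowBlk (E * G) i‖ ≤ γ) (hτ : 7 * β * √(n * d) ≤ n * τ)
    (hsmall : γ + β * τ + 2 * β ≤ n / 20) :
    ∃ R ∈ nearSet G τ, ∃ H : Fin n → Matrix (Fin d) (Fin d) ℝ, (∀ i, (H i).PosSemidef) ∧
      (∀ i, ‖H i - (n : ℝ) • 1‖ ≤ n / 10) ∧
      ∀ i, rowBlk ((G * Gᵀ + E + (2 * β) • 1) * R) i = H i * rowBlk R i := by
  set B := G * Gᵀ + E + (2 * β) • (1 : Matrix (Fin n × Fin d) (Fin n × Fin d) ℝ) with hB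
  have hBt : Bᵀ = B := by simp [hB, hE]
  have hGmem : G ∈ nearSet G τ :=
    ⟨hG, by simp [finner]; positivity, fun i => by simp⟩
  obtain ⟨R, hRmem, hRmax⟩ := (isCompact_nearSet G τ).exists_isMaxOn ⟨G, hGmem⟩
    (f := fun R => finner (B * R) R)
    (continuous_finner (continuous_const.matrix_mul continuous_id) continuous_id).continuousOn
  obtain ⟨hR, hRτ, hRG⟩ := hRmem
  obtain ⟨P, Q, hP, hQ, hPQ, hPn⟩ := exists_alignment hn hG hR hRG
  have hQ' : Qᵀ * Q = 1 := mul_eq_one_comm.1 hQ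
  have hS : StiefelBlocks (R * Qᵀ) := hR.mul_orthogonal (by simpa using hQ')
  have hGS : Gᵀ * (R * Qᵀ) = P := by
    rw [← Matrix.mul_assoc, hPQ, Matrix.mul_assoc, hQ, Matrix.mul_one]
  set S := R * Qᵀ with hSdef
  have hexp : ∀ T : Matrix (Fin n × Fin d) (Fin d) ℝ, StiefelBlocks T →
      finner (T - G) (T - G) = 2 * (n * d) - 2 * (Gᵀ * T).trace := by
    intro T hT
    simp only [finner_sub_left, finner_sub_right, hT.finner_self, hG.finner_self]
    rw [finner_comm G T, finner_eq_trace T G, trace_mul_comm]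
    rw [← trace_transpose (Gᵀ * T), transpose_mul, transpose_transpose, trace_mul_comm,
      ← trace_transpose, transpose_mul, transpose_transpose]
    ring
  have hSτ : finner (S - G) (S - G) ≤ τ ^ 2 := by
    refine le_trans ?_ hRτ
    rw [hexp S hS, hexp R hR, hGS, hPQ]
    have h1 := two_finner_polar hP.transpose_eq_self hQ (Q' := 1) (by simp)
    have h2 := finner_mul_self_nonneg hP (Q - 1)
    rw [finner_sub_right, finner_eq_trace, Matrix.mul_assoc, hQ, Matrix.mul_one, finner_eq_trace,
      transpose_one, Matrix.mul_one] at h1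
    linarith
  obtain ⟨T, hT, H, hHp, hHn, hH⟩ :=
    exists_polar_step hn hG hS hβ hτ0 hEβ hEγ hτ hsmall hSτ hP hGS hPn
  have hSR : finner (B * S) S = finner (B * R) R := by
    rw [hSdef, ← Matrix.mul_assoc, finner_mul_right, Matrix.mul_assoc, transpose_transpose, hQ',
      Matrix.mul_one]
  have hle : finner (B * T) T ≤ finner (B * S) S := by rw [hSR]; exact hRmax hT
  have hTS : T = S := by
    set Y := T - S with hY
    have h1 : 0 ≤ finner (B * S) Y := by
      rw [finner_eq_sum_rowBlk]
      refine Finset.sum_nonneg fun i _ => ?_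
      have e1 := two_finner_polar (hHp i).transpose_eq_self (hT.1 i) (hS i)
      have e2 := finner_mul_self_nonneg (hHp i) (rowBlk T i - rowBlk S i)
      rw [hH, hY, rowBlk_sub]
      linarith
    have h2 : finner (B * T) T = finner (B * S) S + 2 * finner (B * S) Y + finner (B * Y) Y := by
      have e1 : finner (B * Y) S = finner (B * S) Y := by
        rw [finner_mul_left, hBt, finner_comm]
      rw [show T = S + Y from by rw [hY, add_sub_cancel], Matrix.mul_add]
      simp only [finner_add_left, finner_add_right, e1]
      ring
    have h3 : β * finner Y Y ≤ finner (B * Y) Y := by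
      have e1 := neg_le_finner_mul E Y
      have e2 : 0 ≤ finner (G * Gᵀ * Y) Y := by
        rw [Matrix.mul_assoc, finner_mul_left]; exact finner_self_nonneg _
      rw [hB, Matrix.add_mul, Matrix.add_mul, finner_add_left, finner_add_left, Matrix.smul_mul,
        Matrix.one_mul, finner_smul_left]
      nlinarith [finner_self_nonneg Y]
    have h4 := finner_self_nonneg Y
    have h5 : finner Y Y = 0 := by nlinarith
    exact sub_eq_zero.1 (eq_zero_of_finner_self h5)
  exact ⟨S, hTS ▸ hT, H, hHp, hHn, fun i => by rw [hH, hTS]⟩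

end Critical

section Tightness

open scoped Matrix.Norms.L2Operator

variable {n d p : ℕ}

lemma vnorm_sq_prod (x : Fin n × Fin d → ℝ) :
    vnorm x ^ 2 = ∑ i, vnorm (fun a => x (i, a)) ^ 2 := by
  simp only [vnorm_sq, dotProduct, Fintype.sum_prod_type]

lemma vnorm_mulVec_sq_le_of_rowBlk {X : Matrix (Fin n × Fin d) (Fin p) ℝ} {t : ℝ}
    (hX : ∀ i, ‖rowBlk X i‖ ≤ t) (u : Fin p → ℝ) :
    vnorm (X *ᵥ u) ^ 2 ≤ n * (t * vnorm u) ^ 2 := by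
  rw [vnorm_sq_prod]
  calc ∑ i, vnorm (fun a => (X *ᵥ u) (i, a)) ^ 2 ≤ ∑ _i : Fin n, (t * vnorm u) ^ 2 := by
        refine Finset.sum_le_sum fun i _ => pow_le_pow_left₀ (vnorm_nonneg _) ?_ 2
        exact (vnorm_mulVec_le (rowBlk X i) u).trans
          (mul_le_mul_of_nonneg_right (hX i) (vnorm_nonneg u))
    _ = n * (t * vnorm u) ^ 2 := by simp

lemma le_dotProduct_blkDiag_mulVec {H : Fin n → Matrix (Fin d) (Fin d) ℝ} {r δ : ℝ}
    (hH : ∀ i, ‖H i - r • 1‖ ≤ δ) (x : Fin n × Fin d → ℝ) :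
    (r - δ) * vnorm x ^ 2 ≤ x ⬝ᵥ (blkDiag H *ᵥ x) := by
  have h : x ⬝ᵥ (blkDiag H *ᵥ x) =
      ∑ i, (fun a => x (i, a)) ⬝ᵥ (H i *ᵥ fun a => x (i, a)) := by
    simp only [dotProduct, mulVec, blkDiag, Fintype.sum_prod_type, ite_mul, zero_mul]
    refine Finset.sum_congr rfl fun i _ => Finset.sum_congr rfl fun a _ => ?_
    congr 1
    rw [Finset.sum_comm]
    simp
  rw [h, vnorm_sq_prod, Finset.mul_sum]
  refine Finset.sum_le_sum fun i _ => ?_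
  set y : Fin d → ℝ := fun a => x (i, a)
  have h1 := bilin_le (H i - r • 1) (-y) y
  have h2 : (-y) ⬝ᵥ ((H i - r • 1) *ᵥ y) = r * vnorm y ^ 2 - y ⬝ᵥ (H i *ᵥ y) := by
    rw [sub_mulVec, smul_mulVec, one_mulVec, neg_dotProduct, dotProduct_sub, dotProduct_smul,
      vnorm_sq, smul_eq_mul]
    ring
  have h3 : vnorm (-y) = vnorm y := by
    have := vnorm_smul (-1) y
    simpa using this
  rw [h2, h3] at h1
  nlinarith [mul_le_mul_of_nonneg_right (hH i) (sq_nonneg (vnorm y))]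

/-- Deterministic tightness: the relaxation is tight as soon as the noise is small in operator
norm and incoherent with the signal. -/
theorem tight_of_noise_le (hn : 0 < n) {G : Matrix (Fin n × Fin d) (Fin d) ℝ}
    (hG : StiefelBlocks G)
    {E : Matrix (Fin n × Fin d) (Fin n × Fin d) ℝ} (hE : Eᵀ = E) {β γ τ : ℝ} (hβ : 0 < β)
    (hτ0 : 0 ≤ τ)
    (hEβ : ‖E‖ ≤ β) (hEγ : ∀ i, ‖rowBlk (E * G) i‖ ≤ γ) (hτ : 7 * β * √(n * d) ≤ n * τ)
    (hsmall : γ + β * τ + 2 * β ≤ n / 20) :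
    ∃ X, sdpMaximizer (G * Gᵀ + E) X ∧ (∀ Y, sdpMaximizer (G * Gᵀ + E) Y → Y = X) ∧
      X.rank = d ∧
      ∃ R : Matrix (Fin n × Fin d) (Fin d) ℝ, progPMaximizer (G * Gᵀ + E) R ∧ X = R * Rᵀ := by
  have hn' : (0 : ℝ) < n := Nat.cast_pos.2 hn
  have hγ : 0 ≤ γ := (norm_nonneg _).trans (hEγ ⟨0, hn⟩)
  obtain ⟨R, ⟨hR, -, hRG⟩, H, hHp, hHn, hH⟩ :=
    exists_critical hn hG hE hβ hτ0 hEβ hEγ hτ hsmall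
  have hB : (G * Gᵀ + E + (2 * β) • (1 : Matrix (Fin n × Fin d) (Fin n × Fin d) ℝ))ᵀ =
      G * Gᵀ + E + (2 * β) • 1 := by
    rw [transpose_add, transpose_add, hE, transpose_mul, transpose_transpose, transpose_smul,
      transpose_one]
  suffices hgap : ∀ x, Rᵀ *ᵥ x = 0 → (n : ℝ) / 2 * vnorm x ^ 2 ≤
      x ⬝ᵥ ((blkDiag H - (G * Gᵀ + E + (2 * β) • 1)) *ᵥ x) by
    obtain ⟨h1, h2, h3, h4⟩ := tight_of_certificate hn.ne' hR rfl hB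
      (fun i => (hHp i).transpose_eq_self) hH (half_pos hn') hgap
    exact ⟨R * Rᵀ, h1, h2, h3, R, h4, rfl⟩
  intro x hx
  have e1 := le_dotProduct_blkDiag_mulVec hHn x
  have e2 : x ⬝ᵥ ((G * Gᵀ) *ᵥ x) ≤ n / 16 * vnorm x ^ 2 := by
    set u := Gᵀ *ᵥ x with hu
    have f1 : x ⬝ᵥ ((G * Gᵀ) *ᵥ x) = vnorm u ^ 2 := by
      rw [← mulVec_mulVec, dotProduct_mulVec, ← mulVec_transpose, vnorm_sq]
    have f2 : vnorm u ^ 2 = -(x ⬝ᵥ ((R - G) *ᵥ u)) := by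
      rw [dotProduct_mulVec, ← mulVec_transpose, transpose_sub, sub_mulVec, hx, zero_sub,
        neg_dotProduct, neg_neg, vnorm_sq]
    have f3 : vnorm u ^ 2 ≤ vnorm x * vnorm ((R - G) *ᵥ u) := by
      have := dotProduct_le_vnorm (-x) ((R - G) *ᵥ u)
      rw [neg_dotProduct, ← f2] at this
      have h3 : vnorm (-x) = vnorm x := by simpa using vnorm_smul (-1) x
      rwa [h3] at this
    have f4 := vnorm_mulVec_sq_le_of_rowBlk (X := R - G) (t := 1 / 4)
      (fun i => by rw [rowBlk_sub]; exact hRG i) u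
    rw [f1]
    have f5 : vnorm u ^ 2 * vnorm u ^ 2 ≤ n / 16 * vnorm x ^ 2 * vnorm u ^ 2 := by
      calc vnorm u ^ 2 * vnorm u ^ 2
          ≤ (vnorm x * vnorm ((R - G) *ᵥ u)) * (vnorm x * vnorm ((R - G) *ᵥ u)) :=
            mul_self_le_mul_self (sq_nonneg _) f3
        _ = vnorm x ^ 2 * vnorm ((R - G) *ᵥ u) ^ 2 := by ring
        _ ≤ vnorm x ^ 2 * (n * (1 / 4 * vnorm u) ^ 2) := by gcongr
        _ = n / 16 * vnorm x ^ 2 * vnorm u ^ 2 := by ring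
    rcases (sq_nonneg (vnorm u)).eq_or_lt with h0 | h0
    · rw [← h0]; positivity
    · exact le_of_mul_le_mul_right f5 h0
  have e3 : x ⬝ᵥ (E *ᵥ x) ≤ β * vnorm x ^ 2 := by
    have := bilin_le E x x
    nlinarith [mul_le_mul_of_nonneg_right hEβ (sq_nonneg (vnorm x))]
  rw [sub_mulVec, add_mulVec, add_mulVec, smul_mulVec, one_mulVec, dotProduct_sub,
    dotProduct_add, dotProduct_add, dotProduct_smul, ← vnorm_sq, smul_eq_mul]
  have h5 : β ≤ n / 40 := by nlinarith
  nlinarith [mul_le_mul_of_nonneg_right h5 (sq_nonneg (vnorm x)),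
    mul_nonneg hn'.le (sq_nonneg (vnorm x))]

end Tightness

section Net

open scoped Matrix.Norms.L2Operator

variable {m k : Type*} [Fintype m] [Fintype k]

/-- `N` is a net, at scale `1`, of the Euclidean ball of radius `2`. -/
def IsBallNet (N : Finset (m → ℝ)) : Prop :=
  (∀ v ∈ N, vnorm v ≤ 2) ∧ ∀ x, vnorm x ≤ 2 → ∃ v ∈ N, vnorm (x - v) ≤ 1

open Classical in
lemma exists_isBallNet (m : Type*) [Fintype m] :
    ∃ N : Finset (m → ℝ), IsBallNet N ∧ N.card ≤ 5 ^ Fintype.card m := by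
  let Sep : Finset (EuclideanSpace ℝ m) → Prop := fun s =>
    (∀ c ∈ s, ‖c‖ ≤ 2) ∧ ∀ c ∈ s, ∀ d ∈ s, c ≠ d → 1 ≤ ‖c - d‖
  have hbound : ∀ s, Sep s → s.card ≤ 5 ^ Fintype.card m := fun s hs => by
    simpa using Besicovitch.card_le_of_separated s hs.1 hs.2
  let P : ℕ → Prop := fun j => ∃ s, Sep s ∧ s.card = j
  have h0 : P 0 := ⟨∅, ⟨by simp, by simp⟩, rfl⟩
  obtain ⟨s, hs, hcard⟩ := Nat.findGreatest_spec (P := P) (Nat.zero_le (5 ^ Fintype.card m)) h0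
  have hmax : ∀ s', Sep s' → s'.card ≤ s.card := fun s' hs' => by
    rw [hcard]
    exact Nat.le_findGreatest (hbound s' hs') ⟨s', hs', rfl⟩
  refine ⟨s.image WithLp.ofLp, ⟨fun v hv => ?_, fun x hx => ?_⟩,
    Finset.card_image_le.trans (hbound s hs)⟩
  · obtain ⟨c, hc, rfl⟩ := Finset.mem_image.1 hv
    exact hs.1 c hc
  · set y : EuclideanSpace ℝ m := WithLp.toLp 2 x with hy
    by_contra! hcon
    have hfar : ∀ c ∈ s, 1 < ‖y - c‖ := fun c hc =>
      hcon c.ofLp (Finset.mem_image_of_mem _ hc)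
    have hys : y ∉ s := fun h => by
      have := hfar y h
      rw [sub_self, norm_zero] at this
      linarith
    have hSep : Sep (insert y s) := by
      refine ⟨fun c hc => ?_, fun c hc e he hce => ?_⟩
      · rcases Finset.mem_insert.1 hc with rfl | hc
        · exact hx
        · exact hs.1 c hc
      · rcases Finset.mem_insert.1 hc with hc | hc <;> rcases Finset.mem_insert.1 he with he | he
        · exact absurd (hc.trans he.symm) hce
        · rw [hc]; exact (hfar e he).le
        · rw [he, norm_sub_rev]; exact (hfar c hc).le
        · exact hs.2 c hc e he hce
    have := hmax _ hSep
    rw [Finset.card_insert_of_notMem hys] at this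
    omega

lemma IsBallNet.vnorm_le {N : Finset (m → ℝ)} (hN : IsBallNet N) {w : m → ℝ} {t : ℝ}
    (h : ∀ v ∈ N, v ⬝ᵥ w ≤ t) : vnorm w ≤ t := by
  have key : ∀ x, vnorm x ≤ 2 → x ⬝ᵥ w ≤ t + vnorm w := fun x hx => by
    obtain ⟨v, hv, hxv⟩ := hN.2 x hx
    have h1 := dotProduct_le_vnorm (x - v) w
    rw [sub_dotProduct] at h1
    have h2 := mul_le_mul_of_nonneg_right hxv (vnorm_nonneg w)
    linarith [h v hv]
  rcases (vnorm_nonneg w).eq_or_lt with h0 | h0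
  · have := key 0 (by
      have h1 := vnorm_smul (0 : ℝ) w
      rw [zero_smul, abs_zero, zero_mul] at h1
      rw [h1]; norm_num)
    rw [zero_dotProduct, ← h0] at this
    linarith
  · have h1 := key ((2 / vnorm w) • w) (by
      rw [vnorm_smul, abs_of_pos (by positivity), div_mul_cancel₀ _ h0.ne'])
    rw [smul_dotProduct, ← vnorm_sq, smul_eq_mul, sq, ← mul_assoc, div_mul_cancel₀ _ h0.ne'] at h1
    linarith

lemma norm_le_of_isBallNet [DecidableEq m] [DecidableEq k] {N : Finset (m → ℝ)}
    {N' : Finset (k → ℝ)} (hN : IsBallNet N)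
    (hN' : IsBallNet N') {M : Matrix m k ℝ} {t : ℝ} (ht : 0 ≤ t)
    (h : ∀ u ∈ N, ∀ v ∈ N', u ⬝ᵥ (M *ᵥ v) ≤ t) : ‖M‖ ≤ t := by
  rw [← norm_transpose_eq]
  refine norm_le_of_vnorm_mulVec ht fun u => hN'.vnorm_le fun v hv => ?_
  rw [dotProduct_mulVec, vecMul_transpose, dotProduct_comm]
  have h1 := hN.vnorm_le (w := M *ᵥ v) fun u hu => h u hu v hv
  have h2 := dotProduct_le_vnorm u (M *ᵥ v)
  nlinarith [vnorm_nonneg u]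

/-- Passing from a tail bound on the bilinear forms to one on the operator norm. -/
lemma measure_lt_norm_le [DecidableEq m] [DecidableEq k] {Ω : Type*} [MeasurableSpace Ω]
    (μ : Measure Ω) (L : Ω → Matrix m k ℝ) {t b : ℝ} (ht : 0 ≤ t) (hb : 0 ≤ b)
    (h : ∀ u v, vnorm u ≤ 2 → vnorm v ≤ 2 →
      μ {ω | t ≤ u ⬝ᵥ (L ω *ᵥ v)} ≤ ENNReal.ofReal b) :
    μ {ω | t < ‖L ω‖} ≤
      ENNReal.ofReal (5 ^ Fintype.card m * 5 ^ Fintype.card k * b) := by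
  obtain ⟨N, hN, hNc⟩ := exists_isBallNet m
  obtain ⟨N', hN', hNc'⟩ := exists_isBallNet k
  have hsub : {ω | t < ‖L ω‖} ⊆ ⋃ p ∈ N ×ˢ N', {ω | t ≤ p.1 ⬝ᵥ (L ω *ᵥ p.2)} := by
    intro ω hω
    by_contra hcon
    simp only [Set.mem_iUnion, not_exists, Finset.mem_product] at hcon
    refine (not_le.2 hω) (norm_le_of_isBallNet hN hN' ht fun u hu v hv => ?_)
    exact (not_le.1 (hcon (u, v) ⟨hu, hv⟩)).le
  calc μ {ω | t < ‖L ω‖} ≤ ∑ p ∈ N ×ˢ N', μ {ω | t ≤ p.1 ⬝ᵥ (L ω *ᵥ p.2)} :=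
        (measure_mono hsub).trans (measure_biUnion_finset_le _ _)
    _ ≤ ∑ _p ∈ N ×ˢ N', ENNReal.ofReal b := by
        refine Finset.sum_le_sum fun p hp => ?_
        rw [Finset.mem_product] at hp
        exact h _ _ (hN.1 _ hp.1) (hN'.1 _ hp.2)
    _ = ENNReal.ofReal ((N.card * N'.card : ℕ) * b) := by
        rw [Finset.sum_const, Finset.card_product, nsmul_eq_mul,
          ENNReal.ofReal_mul (Nat.cast_nonneg _), ENNReal.ofReal_natCast]
    _ ≤ _ := by
        refine ENNReal.ofReal_le_ofReal (mul_le_mul_of_nonneg_right ?_ hb)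
        exact_mod_cast Nat.mul_le_mul hNc hNc'

end Net

section Tail

open scoped NNReal

lemma hasSubgaussianMGF_gaussianReal : HasSubgaussianMGF id 1 (gaussianReal 0 1) where
  integrable_exp_mul t := integrable_exp_mul_gaussianReal t
  mgf_le t := by
    rw [mgf_gaussianReal (μ := 0) (v := 1) Measure.map_id]
    simp

lemma ProbabilityTheory.HasSubgaussianMGF.mono {Ω : Type*} [MeasurableSpace Ω] {μ : Measure Ω}
    {X : Ω → ℝ} {c c' : ℝ≥0} (h : HasSubgaussianMGF X c μ) (hc : c ≤ c') :
    HasSubgaussianMGF X c' μ where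
  integrable_exp_mul := h.integrable_exp_mul
  mgf_le t := (h.mgf_le t).trans (Real.exp_le_exp.2 (by gcongr))

lemma hasSubgaussianMGF_linear {ι : Type*} [Fintype ι] (a : ι → ℝ) {K : ℝ≥0}
    (hK : ∑ p, a p ^ 2 ≤ K) :
    HasSubgaussianMGF (fun ω : ι → ℝ => ∑ p, a p * ω p) K
      (Measure.pi fun _ => gaussianReal 0 1) := by
  have hind : iIndepFun (fun p (ω : ι → ℝ) => a p * ω p)
      (Measure.pi fun _ => gaussianReal 0 1) :=
    iIndepFun_pi (X := fun p x => a p * x) fun p => (measurable_const_mul (a p)).aemeasurable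
  refine (HasSubgaussianMGF.sum_of_iIndepFun hind (s := Finset.univ)
    (c := fun p => ⟨a p ^ 2, sq_nonneg _⟩ * 1) fun p _ => ?_).mono ?_
  · refine HasSubgaussianMGF.const_mul (X := fun ω : ι → ℝ => ω p) ?_ (a p)
    have hmp := measurePreserving_eval (fun _ : ι => gaussianReal 0 1) p
    refine HasSubgaussianMGF.of_map (X := id) hmp.measurable.aemeasurable ?_
    rw [hmp.map_eq]
    exact hasSubgaussianMGF_gaussianReal
  · rw [← NNReal.coe_le_coe]
    rw [NNReal.coe_sum]
    refine le_trans (le_of_eq (Finset.sum_congr rfl fun p _ => ?_)) hK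
    change a p ^ 2 * 1 = _
    ring

variable {n d : ℕ}

/-- Coefficients of the linear form `ω ↦ xᵀ W y`. -/
def bilinCoeff (x y : Fin n × Fin d → ℝ) (p : (Fin n × Fin d) × (Fin n × Fin d)) : ℝ :=
  if p.1.1 < p.2.1 then x p.1 * y p.2 + x p.2 * y p.1 else 0

lemma dotProduct_Wof_mulVec (x y : Fin n × Fin d → ℝ)
    (ω : ((Fin n × Fin d) × (Fin n × Fin d)) → ℝ) :
    x ⬝ᵥ (Wof ω *ᵥ y) = ∑ p, bilinCoeff x y p * ω p := by
  have h1 : ∀ q r : Fin n × Fin d, x q * (Wof ω q r * y r) =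
      (if q.1 < r.1 then x q * y r * ω (q, r) else 0) +
        (if r.1 < q.1 then x q * y r * ω (r, q) else 0) := by
    intro q r
    rcases lt_trichotomy q.1 r.1 with h | h | h
    · simp [Wof, h, h.not_gt]; ring
    · simp [Wof, h]
    · simp [Wof, h, h.not_gt]; ring
  have h2 : ∀ q r : Fin n × Fin d, bilinCoeff x y (q, r) * ω (q, r) =
      (if q.1 < r.1 then x q * y r * ω (q, r) else 0) +
        (if q.1 < r.1 then x r * y q * ω (q, r) else 0) := by
    intro q r
    unfold bilinCoeff
    split_ifs <;> ring
  rw [Fintype.sum_prod_type]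
  simp only [dotProduct, mulVec, Finset.mul_sum, h1, h2, Finset.sum_add_distrib]
  congr 1
  exact Finset.sum_comm

lemma sum_bilinCoeff_sq_le (x y : Fin n × Fin d → ℝ) :
    ∑ p, bilinCoeff x y p ^ 2 ≤ 4 * (vnorm x ^ 2 * vnorm y ^ 2) := by
  have h1 : ∀ q r : Fin n × Fin d, bilinCoeff x y (q, r) ^ 2 ≤
      2 * (x q * x q * (y r * y r)) + 2 * (y q * y q * (x r * x r)) := by
    intro q r
    unfold bilinCoeff
    split_ifs
    · nlinarith [sq_nonneg (x q * y r - x r * y q)]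
    · nlinarith [sq_nonneg (x q * y r), sq_nonneg (x r * y q)]
  calc ∑ p, bilinCoeff x y p ^ 2
      ≤ ∑ q, ∑ r, (2 * (x q * x q * (y r * y r)) + 2 * (y q * y q * (x r * x r))) := by
        rw [Fintype.sum_prod_type]
        exact Finset.sum_le_sum fun q _ => Finset.sum_le_sum fun r _ => h1 q r
    _ = 4 * (vnorm x ^ 2 * vnorm y ^ 2) := by
        simp only [Finset.sum_add_distrib, ← Finset.mul_sum, ← Finset.sum_mul, vnorm_sq, dotProduct]
        ring

lemma measure_le_dotProduct_Wof {x y : Fin n × Fin d → ℝ} {K t : ℝ} (ht : 0 ≤ t)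
    (hK : vnorm x ^ 2 * vnorm y ^ 2 ≤ K) :
    gaussianEnsemble n d {ω | t ≤ x ⬝ᵥ (Wof ω *ᵥ y)} ≤
      ENNReal.ofReal (Real.exp (-t ^ 2 / (8 * K))) := by
  have hK0 : 0 ≤ K := le_trans (by positivity) hK
  have h := hasSubgaussianMGF_linear (bilinCoeff x y) (K := ⟨4 * K, by positivity⟩)
    ((sum_bilinCoeff_sq_le x y).trans (by change _ ≤ 4 * K; linarith))
  have h2 := h.measure_ge_le ht
  simp only [dotProduct_Wof_mulVec]
  rw [← ENNReal.ofReal_toReal (a := gaussianEnsemble n d _)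
    (by unfold gaussianEnsemble; exact measure_ne_top _ _)]
  refine ENNReal.ofReal_le_ofReal (h2.trans (Real.exp_le_exp.2 (le_of_eq ?_)))
  change -t ^ 2 / (2 * (4 * K)) = _
  ring

open scoped Matrix.Norms.L2Operator

lemma transpose_Wof (ω : ((Fin n × Fin d) × (Fin n × Fin d)) → ℝ) : (Wof ω)ᵀ = Wof ω := by
  ext q r
  rcases lt_trichotomy q.1 r.1 with h | h | h
  · simp [Wof, h, h.not_gt]
  · simp [Wof, h]
  · simp [Wof, h, h.not_gt]

lemma measure_lt_norm_Wof {t : ℝ} (ht : 0 ≤ t) :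
    gaussianEnsemble n d {ω | t < ‖(Wof ω : Matrix (Fin n × Fin d) _ ℝ)‖} ≤
      ENNReal.ofReal (25 ^ (n * d) * Real.exp (-t ^ 2 / 128)) := by
  refine (measure_lt_norm_le (gaussianEnsemble n d) Wof ht (Real.exp_pos (-t ^ 2 / 128)).le
    fun u v hu hv => ?_).trans (le_of_eq ?_)
  · refine (measure_le_dotProduct_Wof ht (K := 16) ?_).trans (le_of_eq (by norm_num))
    have h1 := pow_le_pow_left₀ (vnorm_nonneg u) hu 2
    have h2 := pow_le_pow_left₀ (vnorm_nonneg v) hv 2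
    calc _ ≤ (2 : ℝ) ^ 2 * 2 ^ 2 := by gcongr
      _ = 16 := by norm_num
  · rw [Fintype.card_prod, Fintype.card_fin, Fintype.card_fin, ← mul_pow]; norm_num

lemma StiefelBlocks.vnorm_mulVec_sq {G : Matrix (Fin n × Fin d) (Fin d) ℝ} (hG : StiefelBlocks G)
    (v : Fin d → ℝ) : vnorm (G *ᵥ v) ^ 2 = n * vnorm v ^ 2 := by
  rw [vnorm_sq_prod]
  have h : ∀ i, vnorm (fun a => (G *ᵥ v) (i, a)) = vnorm v := fun i => hG.vnorm_mulVec i v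
  simp [h]

lemma measure_lt_norm_rowBlk_Wof {G : Matrix (Fin n × Fin d) (Fin d) ℝ}
    (hG : StiefelBlocks G) (i : Fin n) {t : ℝ} (ht : 0 ≤ t) :
    gaussianEnsemble n d {ω | t < ‖rowBlk (Wof ω * G) i‖} ≤
      ENNReal.ofReal (25 ^ d * Real.exp (-t ^ 2 / (128 * n))) := by
  refine (measure_lt_norm_le (gaussianEnsemble n d) (fun ω => rowBlk (Wof ω * G) i) ht
    (Real.exp_pos (-t ^ 2 / (128 * n))).le fun u v hu hv => ?_).trans (le_of_eq ?_)
  · set x : Fin n × Fin d → ℝ := fun q => if q.1 = i then u q.2 else 0 with hx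
    have hxu : vnorm x ^ 2 = vnorm u ^ 2 := by
      simp [vnorm_sq, hx, dotProduct, Fintype.sum_prod_type]
    have hform : ∀ ω, u ⬝ᵥ (rowBlk (Wof ω * G) i *ᵥ v) = x ⬝ᵥ (Wof ω *ᵥ (G *ᵥ v)) := by
      intro ω
      have h1 : rowBlk (Wof ω * G) i *ᵥ v = fun a => (Wof ω *ᵥ (G *ᵥ v)) (i, a) := by
        rw [mulVec_mulVec]; rfl
      rw [h1]
      simp only [hx, dotProduct, Fintype.sum_prod_type, ite_mul, zero_mul]
      rw [Finset.sum_comm]; simp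
    simp only [hform]
    refine (measure_le_dotProduct_Wof ht (K := 16 * n) ?_).trans (le_of_eq ?_)
    · rw [hxu, hG.vnorm_mulVec_sq]
      have h1 := pow_le_pow_left₀ (vnorm_nonneg u) hu 2
      have h2 := pow_le_pow_left₀ (vnorm_nonneg v) hv 2
      calc _ ≤ (2 : ℝ) ^ 2 * (n * 2 ^ 2) := by gcongr
        _ = 16 * n := by ring
    · congr 3; ring
  · rw [Fintype.card_fin, ← mul_pow]; norm_num

end Tail

section Probability

open scoped Matrix.Norms.L2Operator

variable {n d : ℕ}

lemma twentyFive_pow_mul_exp_le (m : ℕ) {x : ℝ} :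
    25 ^ m * Real.exp (-x) ≤ Real.exp (4 * m - x) := by
  have h : (25 : ℝ) ≤ Real.exp 4 := by
    have h1 : (2.7 : ℝ) ≤ Real.exp 1 := by linarith [Real.exp_one_gt_d9]
    have h2 : Real.exp 4 = Real.exp 1 ^ 4 := by rw [← Real.exp_nat_mul]; norm_num
    rw [h2]
    calc (25 : ℝ) ≤ 2.7 ^ 4 := by norm_num
      _ ≤ _ := by gcongr
  calc 25 ^ m * Real.exp (-x) ≤ Real.exp 4 ^ m * Real.exp (-x) := by gcongr
    _ = Real.exp (4 * m - x) := by
      rw [← Real.exp_nat_mul, ← Real.exp_add]; congr 1; ring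

lemma exp_neg_le_inv {x : ℝ} (hx : 0 < x) : Real.exp (-x) ≤ 1 / x := by
  rw [Real.exp_neg, ← one_div]
  exact one_div_le_one_div_of_le hx (by linarith [Real.add_one_le_exp x])

/-- Probability that the noise is large in operator norm or correlated with the signal. -/
lemma measure_large_noise_le {G : Matrix (Fin n × Fin d) (Fin d) ℝ} (hG : StiefelBlocks G) {a b : ℝ}
    (ha : 1 ≤ a) (hb : 1 ≤ b) (hn : a ^ 4 = n) (hd : b ^ 4 = d) :
    gaussianEnsemble n d ({ω | 26 * (a ^ 2 * b ^ 2) < ‖(Wof ω : Matrix (Fin n × Fin d) _ ℝ)‖} ∪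
      ⋃ i, {ω | 32 * (a ^ 3 * b ^ 3) < ‖rowBlk (Wof ω * G) i‖}) ≤ ENNReal.ofReal (2 / n) := by
  have ha0 : 0 < a := by linarith
  have hb0 : 0 < b := by linarith
  have hn0 : (0 : ℝ) < n := by rw [← hn]; positivity
  have h1 : gaussianEnsemble n d
      {ω | 26 * (a ^ 2 * b ^ 2) < ‖(Wof ω : Matrix (Fin n × Fin d) _ ℝ)‖} ≤
        ENNReal.ofReal (1 / n) := by
    refine (measure_lt_norm_Wof (by positivity)).trans (ENNReal.ofReal_le_ofReal ?_)
    have hbig : (1 : ℝ) ≤ b ^ 4 := one_le_pow₀ hb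
    have h := twentyFive_pow_mul_exp_le (n * d) (x := 5 * (n * d))
    calc 25 ^ (n * d) * Real.exp (-(26 * (a ^ 2 * b ^ 2)) ^ 2 / 128)
        ≤ 25 ^ (n * d) * Real.exp (-(5 * (n * d))) := by
          gcongr
          rw [← hn, ← hd]
          nlinarith [show 0 ≤ a ^ 4 * b ^ 4 by positivity]
      _ ≤ Real.exp (-n) := by
          refine h.trans (Real.exp_le_exp.2 ?_)
          push_cast
          rw [← hd]
          nlinarith
      _ ≤ 1 / n := exp_neg_le_inv hn0
  have h2 : ∀ i, gaussianEnsemble n d {ω | 32 * (a ^ 3 * b ^ 3) < ‖rowBlk (Wof ω * G) i‖} ≤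
      ENNReal.ofReal (1 / n ^ 2) := by
    intro i
    refine (measure_lt_norm_rowBlk_Wof hG i (by positivity)).trans (ENNReal.ofReal_le_ofReal ?_)
    have h := twentyFive_pow_mul_exp_le d (x := 8 * (a ^ 2 * b ^ 6))
    have hb6 : b ^ 4 ≤ a ^ 2 * b ^ 6 := by
      calc b ^ 4 ≤ b ^ 6 := pow_le_pow_right₀ hb (by norm_num)
        _ ≤ a ^ 2 * b ^ 6 := le_mul_of_one_le_left (by positivity) (one_le_pow₀ ha)
    have ha6 : a ^ 2 ≤ a ^ 2 * b ^ 6 := le_mul_of_one_le_right (by positivity) (one_le_pow₀ hb)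
    have hexp : -(32 * (a ^ 3 * b ^ 3)) ^ 2 / (128 * n) = -(8 * (a ^ 2 * b ^ 6)) := by
      rw [← hn]; field_simp; ring
    rw [hexp]
    calc _ ≤ _ := h
      _ ≤ Real.exp (-(a ^ 2)) ^ 4 := by
          rw [← Real.exp_nat_mul]
          refine Real.exp_le_exp.2 ?_
          rw [← hd]
          push_cast
          linarith
      _ ≤ (1 / a ^ 2) ^ 4 := by gcongr; exact exp_neg_le_inv (by positivity)
      _ = 1 / n ^ 2 := by rw [← hn, div_pow]; ring
  refine (measure_union_le _ _).trans ?_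
  refine (add_le_add h1 ((measure_iUnion_fintype_le _ _).trans
    (Finset.sum_le_sum fun i _ => h2 i))).trans (le_of_eq ?_)
  rw [Finset.sum_const, Finset.card_univ, Fintype.card_fin, nsmul_eq_mul,
    ← ENNReal.ofReal_natCast, ← ENNReal.ofReal_mul (Nat.cast_nonneg _),
    ← ENNReal.ofReal_add (by positivity) (by positivity)]
  congr 1
  field_simp
  norm_num

/-- Tightness on the event that the noise is neither large nor correlated with the signal. -/
lemma tight_of_gaussian_bounds {G : Matrix (Fin n × Fin d) (Fin d) ℝ} (hG : StiefelBlocks G)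
    {a b σ : ℝ} (ha : 1 ≤ a) (hb : 1 ≤ b) (hn : a ^ 4 = n) (hd : b ^ 4 = d) (hσ : 0 < σ)
    (hσab : σ * b ^ 3 ≤ 1 / 5000 * a) {W : Matrix (Fin n × Fin d) (Fin n × Fin d) ℝ}
    (hW : Wᵀ = W) (hWβ : ‖W‖ ≤ 26 * (a ^ 2 * b ^ 2))
    (hWγ : ∀ i, ‖rowBlk (W * G) i‖ ≤ 32 * (a ^ 3 * b ^ 3)) :
    ∃ X, sdpMaximizer (G * Gᵀ + σ • W) X ∧ (∀ Y, sdpMaximizer (G * Gᵀ + σ • W) Y → Y = X) ∧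
      X.rank = d ∧
      ∃ R : Matrix (Fin n × Fin d) (Fin d) ℝ,
        progPMaximizer (G * Gᵀ + σ • W) R ∧ X = R * Rᵀ := by
  have ha0 : 0 < a := by linarith
  have hb0 : 0 < b := by linarith
  have hn0 : (0 : ℝ) < n := by rw [← hn]; positivity
  refine tight_of_noise_le (Nat.cast_pos.1 hn0) hG (β := 26 * σ * (a ^ 2 * b ^ 2))
    (γ := 32 * σ * (a ^ 3 * b ^ 3)) (τ := 182 * σ * b ^ 4) ?_ (by positivity) (by positivity)
    ?_ (fun i => ?_) ?_ ?_
  · rw [transpose_smul, hW]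
  · rw [norm_smul, Real.norm_of_nonneg hσ.le]
    nlinarith
  · rw [Matrix.smul_mul, rowBlk_smul, norm_smul, Real.norm_of_nonneg hσ.le]
    nlinarith [hWγ i]
  · have : √((n : ℝ) * d) = a ^ 2 * b ^ 2 := by
      rw [← hn, ← hd, show a ^ 4 * b ^ 4 = (a ^ 2 * b ^ 2) ^ 2 by ring,
        Real.sqrt_sq (by positivity)]
    rw [this, ← hn]
    apply le_of_eq
    ring
  · have e1 : 32 * σ * (a ^ 3 * b ^ 3) ≤ 32 / 5000 * a ^ 4 := by
      calc 32 * σ * (a ^ 3 * b ^ 3) = 32 * a ^ 3 * (σ * b ^ 3) := by ring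
        _ ≤ 32 * a ^ 3 * (1 / 5000 * a) := by gcongr
        _ = 32 / 5000 * a ^ 4 := by ring
    have e2 : 26 * σ * (a ^ 2 * b ^ 2) ≤ 26 / 5000 * a ^ 4 := by
      calc 26 * σ * (a ^ 2 * b ^ 2) ≤ 26 * σ * (a ^ 3 * b ^ 3) := by
            gcongr <;> first | assumption | norm_num
        _ = 26 * a ^ 3 * (σ * b ^ 3) := by ring
        _ ≤ 26 * a ^ 3 * (1 / 5000 * a) := by gcongr
        _ = 26 / 5000 * a ^ 4 := by ring
    have e3 : 26 * σ * (a ^ 2 * b ^ 2) * (182 * σ * b ^ 4) ≤ 1 / 1000 * a ^ 4 := by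
      calc 26 * σ * (a ^ 2 * b ^ 2) * (182 * σ * b ^ 4) = 4732 * a ^ 2 * (σ * b ^ 3) ^ 2 := by ring
        _ ≤ 4732 * a ^ 2 * (1 / 5000 * a) ^ 2 := by gcongr
        _ = 4732 / 25000000 * a ^ 4 := by ring
        _ ≤ 1 / 1000 * a ^ 4 := mul_le_mul_of_nonneg_right (by norm_num) (by positivity)
    rw [← hn]
    nlinarith [show 0 ≤ a ^ 4 by positivity]

end Probability

/-- tightness of the SDP relaxation under Gaussian noise. -/
theorem sdp_tightness_gaussian :
    ∃ C₀ > (0 : ℝ), ∃ c > (0 : ℝ), ∀ (n d : ℕ), 2 ≤ n → 1 ≤ d → ∀ σ : ℝ, 0 < σ →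
      σ ≤ C₀ * (n : ℝ) ^ ((1 : ℝ) / 4) * (d : ℝ) ^ (-(3 : ℝ) / 4) →
      ∀ G : Matrix (Fin n × Fin d) (Fin d) ℝ, StiefelBlocks G →
        ENNReal.ofReal (1 - c / n) ≤
          gaussianEnsemble n d
            {ω | ∃ X : Matrix (Fin n × Fin d) (Fin n × Fin d) ℝ,
              sdpMaximizer (G * Gᵀ + σ • Wof ω) X ∧
              (∀ Y, sdpMaximizer (G * Gᵀ + σ • Wof ω) Y → Y = X) ∧
              X.rank = d ∧
              ∃ R : Matrix (Fin n × Fin d) (Fin d) ℝ,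
                progPMaximizer (G * Gᵀ + σ • Wof ω) R ∧ X = R * Rᵀ} := by
  refine ⟨1 / 5000, by norm_num, 2, by norm_num, fun n d hn hd σ hσ hσle G hG => ?_⟩
  have hn1 : (1 : ℝ) ≤ n := by exact_mod_cast (by omega : 1 ≤ n)
  have hd1 : (1 : ℝ) ≤ d := by exact_mod_cast hd
  set a : ℝ := (n : ℝ) ^ ((1 : ℝ) / 4) with ha
  set b : ℝ := (d : ℝ) ^ ((1 : ℝ) / 4) with hb
  have ha1 : 1 ≤ a := Real.one_le_rpow hn1 (by norm_num)
  have hb1 : 1 ≤ b := Real.one_le_rpow hd1 (by norm_num)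
  have hb0 : 0 < b := by linarith
  have ha4 : a ^ 4 = n := by
    rw [ha, ← Real.rpow_natCast, ← Real.rpow_mul (by linarith)]; norm_num
  have hb4 : b ^ 4 = d := by
    rw [hb, ← Real.rpow_natCast, ← Real.rpow_mul (by linarith)]; norm_num
  have hb3 : (d : ℝ) ^ (-(3 : ℝ) / 4) * b ^ 3 = 1 := by
    rw [hb, ← Real.rpow_natCast, ← Real.rpow_mul (by linarith), ← Real.rpow_add (by linarith)]
    norm_num
  have hσab : σ * b ^ 3 ≤ 1 / 5000 * a := by
    calc σ * b ^ 3 ≤ 1 / 5000 * a * (d : ℝ) ^ (-(3 : ℝ) / 4) * b ^ 3 := by gcongr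
      _ = 1 / 5000 * a := by rw [mul_assoc, hb3, mul_one]
  rw [ENNReal.ofReal_sub _ (by positivity), ENNReal.ofReal_one, tsub_le_iff_right]
  refine le_trans ?_ (add_le_add_right (measure_large_noise_le hG ha1 hb1 ha4 hb4) _)
  refine le_trans ?_ (measure_union_le _ _)
  rw [show (1 : ℝ≥0∞) = gaussianEnsemble n d Set.univ by simp [gaussianEnsemble]]
  refine measure_mono fun ω _ => ?_
  by_contra hω
  rw [Set.mem_union, Set.mem_union, not_or, not_or, Set.mem_iUnion, not_exists] at hω
  exact hω.1 (tight_of_gaussian_bounds hG ha1 hb1 ha4 hb4 hσ hσab (transpose_Wof ω)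
    (not_lt.1 hω.2.1) fun i => not_lt.1 (hω.2.2 i))
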